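/- arXiv:2004.10485 — 2 statements merged into one kernel-verified Lean document; each statement's English description precedes it below -/
import Mathlib

section
/- Let E ⊆ ℝ^d be measurable and Q ⊆ ℝ^d a cube with |E∩Q| = λ|Q| for some λ ∈ (0,1). Then H^{d-1}(∂Q ∖ cl*E) ≤ C_d · λ^{-(d-1)/d} · H^{d-1}(∂*E ∩ int Q), where C_d depends only on d. -/
open MeasureTheory Metric Set Filter
open scoped ENNReal

noncomputable def mClos {d : ℕ} (E : Set (EuclideanSpace ℝ (Fin d))) :
    Set (EuclideanSpace ℝ (Fin d)) :=
  {x | 0 < Filter.limsup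
      (fun r : ℝ => volume (Metric.ball x r ∩ E) / ENNReal.ofReal (r ^ d))
      (nhdsWithin 0 (Set.Ioi 0))}

noncomputable def mBdry {d : ℕ} (E : Set (EuclideanSpace ℝ (Fin d))) :
    Set (EuclideanSpace ℝ (Fin d)) :=
  mClos E ∩ mClos Eᶜ

/-- An axis-parallel (closed) cube with lower corner `a` and side length `l`. -/
def cube {d : ℕ} (a : EuclideanSpace ℝ (Fin d)) (l : ℝ) : Set (EuclideanSpace ℝ (Fin d)) :=
  {x | ∀ i, a i ≤ x i ∧ x i ≤ a i + l}


lemma gap_lt (P : Set ℝ) (o b : ℝ) (hob : o < b) (ho : o ∉ P) (hb : b ∈ P) :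
    ∃ c, o ≤ c ∧ c ≤ b ∧ c ∈ frontier P ∧ (c = o ∨ (o < c ∧ Ioo o c ⊆ Pᶜ)) := by
  set S := P ∩ Icc o b with hS
  have hbS : b ∈ S := ⟨hb, hob.le, le_rfl⟩
  have hbdd : BddBelow S := ⟨o, fun x hx => hx.2.1⟩
  set c := sInf S with hc
  have hoc : o ≤ c := le_csInf ⟨b, hbS⟩ fun x hx => hx.2.1
  have hcb : c ≤ b := csInf_le hbdd hbS
  have hcl : c ∈ closure P := closure_mono inter_subset_left (csInf_mem_closure ⟨b, hbS⟩ hbdd)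
  have hIoo : Ioo o c ⊆ Pᶜ := by
    intro x hx hxP
    have : c ≤ x := csInf_le hbdd ⟨hxP, hx.1.le, hx.2.le.trans hcb⟩
    exact absurd hx.2 (not_lt.2 this)
  refine ⟨c, hoc, hcb, ?_, ?_⟩
  · rw [frontier_eq_closure_inter_closure]
    refine ⟨hcl, ?_⟩
    rcases hoc.eq_or_lt with h | h
    · rw [← h]; exact subset_closure ho
    · apply closure_mono hIoo
      rw [closure_Ioo h.ne]; exact ⟨h.le, le_rfl⟩
  · rcases hoc.eq_or_lt with h | h
    · exact Or.inl h.symm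
    · exact Or.inr ⟨h, hIoo⟩

lemma gap_gt (P : Set ℝ) (o b : ℝ) (hob : b < o) (ho : o ∉ P) (hb : b ∈ P) :
    ∃ c, b ≤ c ∧ c ≤ o ∧ c ∈ frontier P ∧ (c = o ∨ (c < o ∧ Ioo c o ⊆ Pᶜ)) := by
  set S := P ∩ Icc b o with hS
  have hbS : b ∈ S := ⟨hb, le_rfl, hob.le⟩
  have hbdd : BddAbove S := ⟨o, fun x hx => hx.2.2⟩
  set c := sSup S with hc
  have hoc : c ≤ o := csSup_le ⟨b, hbS⟩ fun x hx => hx.2.2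
  have hcb : b ≤ c := le_csSup hbdd hbS
  have hcl : c ∈ closure P := closure_mono inter_subset_left (csSup_mem_closure ⟨b, hbS⟩ hbdd)
  have hIoo : Ioo c o ⊆ Pᶜ := by
    intro x hx hxP
    have : x ≤ c := le_csSup hbdd ⟨hxP, hcb.trans hx.1.le, hx.2.le⟩
    exact absurd hx.1 (not_lt.2 this)
  refine ⟨c, hcb, hoc, ?_, ?_⟩
  · rw [frontier_eq_closure_inter_closure]
    refine ⟨hcl, ?_⟩
    rcases hoc.eq_or_lt with h | h
    · rw [h]; exact subset_closure ho
    · apply closure_mono hIoo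
      rw [closure_Ioo h.ne]; exact ⟨le_rfl, h.le⟩
  · rcases hoc.eq_or_lt with h | h
    · exact Or.inl h
    · exact Or.inr ⟨h, hIoo⟩

/-- one-dimensional Baire argument -/
lemma oneD (I O : Set ℝ) (G H : ℕ → Set ℝ) (hG : ∀ k, IsClosed (G k)) (hH : ∀ k, IsClosed (H k))
    (hIG : I ⊆ ⋃ k, G k) (hOH : O ⊆ ⋃ k, H k)
    (hGO : ∀ k, ∀ x ∈ G k, x ∉ O) (hHI : ∀ k, ∀ x ∈ H k, x ∉ I)
    (s t : ℝ) (hst : s < t) (hs : s ∈ I) (ht : t ∈ O) (hcov : Icc s t ⊆ I ∪ O)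
    (j1 : ∀ k, ∀ b ∈ G k, ∀ c, b < c → ¬ Ioo b c ⊆ O)
    (j2 : ∀ k, ∀ b ∈ G k, ∀ c, c < b → ¬ Ioo c b ⊆ O)
    (j3 : ∀ k, ∀ b ∈ H k, ∀ c, b < c → ¬ Ioo b c ⊆ I)
    (j4 : ∀ k, ∀ b ∈ H k, ∀ c, c < b → ¬ Ioo c b ⊆ I) : False := by
  have hdisj : ∀ x, x ∈ I → x ∈ O → False := by
    intro x hx hx'
    obtain ⟨k, hk⟩ := mem_iUnion.1 (hIG hx)
    exact hGO k x hk hx'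
  set P : Set ℝ := Iio s ∪ (I ∩ Icc s t) with hP
  have hPI : ∀ x ∈ Icc s t, x ∈ P → x ∈ I := by
    intro x hx hxP
    rcases hxP with h | h
    · exact absurd h (not_lt.2 hx.1)
    · exact h.1
  have hPO : ∀ x ∈ Icc s t, x ∉ P → x ∈ O := by
    intro x hx hxP
    rcases hcov hx with h | h
    · exact absurd (Or.inr ⟨h, hx⟩) hxP
    · exact h
  have hsP : s ∈ P := Or.inr ⟨hs, le_rfl, hst.le⟩
  have htP : t ∉ P := fun h => hdisj t (hPI t ⟨hst.le, le_rfl⟩ h) ht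
  have hBsub : frontier P ⊆ Icc s t := by
    intro x hx
    rw [frontier_eq_closure_inter_closure] at hx
    constructor
    · have : closure Pᶜ ⊆ Ici s := by
        apply closure_minimal _ isClosed_Ici
        intro y hy
        by_contra h
        exact hy (Or.inl (mem_Iio.2 (not_le.1 (fun h' => h (mem_Ici.2 h')))))
      exact this hx.2
    · have : closure P ⊆ Iic t := by
        apply closure_minimal _ isClosed_Iic
        rintro y (hy | hy)
        · exact (le_of_lt hy).trans hst.le
        · exact hy.2.2
      exact this hx.1
  have hBne : (frontier P).Nonempty := by
    rw [nonempty_frontier_iff]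
    exact ⟨⟨s, hsP⟩, fun h => htP (h ▸ mem_univ t)⟩
  have hBcl : IsClosed (frontier P) := isClosed_frontier
  have : CompleteSpace (frontier P) := hBcl.completeSpace_coe
  have : Nonempty (frontier P) := hBne.to_subtype
  let F : ℕ ⊕ ℕ → Set (frontier P) := fun k =>
    Subtype.val ⁻¹' (Sum.elim G H k)
  have hFc : ∀ k, IsClosed (F k) := by
    rintro (k | k)
    · exact (hG k).preimage continuous_subtype_val
    · exact (hH k).preimage continuous_subtype_val
  have hFU : ⋃ k, F k = univ := by
    ext ⟨x, hx⟩
    simp only [mem_iUnion, mem_univ, iff_true]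
    rcases hcov (hBsub hx) with h | h
    · obtain ⟨k, hk⟩ := mem_iUnion.1 (hIG h)
      exact ⟨Sum.inl k, hk⟩
    · obtain ⟨k, hk⟩ := mem_iUnion.1 (hOH h)
      exact ⟨Sum.inr k, hk⟩
  obtain ⟨k, ⟨⟨b, hb⟩, hbi⟩⟩ := nonempty_interior_of_iUnion_of_closed hFc hFU
  rw [mem_interior_iff_mem_nhds, Metric.mem_nhds_iff] at hbi
  obtain ⟨ρ, hρ, hball⟩ := hbi
  have hsub : ∀ c ∈ frontier P, |c - b| < ρ → c ∈ Sum.elim G H k := by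
    intro c hc hcb
    exact @hball ⟨c, hc⟩ (by rw [Metric.mem_ball, Subtype.dist_eq, Real.dist_eq]; exact hcb)
  have hbk := hsub b hb (by simpa using hρ)
  have hbI := hBsub hb
  have hb2 := hb
  rw [frontier_eq_closure_inter_closure] at hb2
  rcases k with k | k
  · simp only [Sum.elim_inl] at hsub hbk
    have hbO := hGO k b hbk
    have hbP : b ∈ P := by
      by_contra h; exact hbO (hPO b hbI h)
    have hbt : b < t := lt_of_le_of_ne hbI.2 (fun h => htP (h ▸ hbP))
    obtain ⟨o, ho, hod⟩ := Metric.mem_closure_iff.1 hb2.2 ρ hρ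
    rw [Real.dist_eq] at hod
    have hob : o ≠ b := fun h => ho (h ▸ hbP)
    rcases lt_or_gt_of_ne hob with h | h
    · have hos : s ≤ o := by
        by_contra h'; exact ho (Or.inl (not_le.1 h'))
      have hoI : o ∈ Icc s t := ⟨hos, h.le.trans hbt.le⟩
      obtain ⟨c, hc1, hc2, hc3, hc4⟩ := gap_lt P o b h ho hbP
      have hck := hsub c hc3 (by rw [abs_lt] at hod ⊢; constructor <;> linarith)
      rcases hc4 with rfl | ⟨hc4, hc5⟩
      · exact hGO k c hck (hPO c hoI ho)
      · refine j2 k c hck o hc4 fun x hx => hPO x ⟨hos.trans hx.1.le, ?_⟩ (hc5 hx)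
        linarith [hx.2]
    · obtain ⟨o', ho', hbo', hoo', hot'⟩ : ∃ o', o' ∉ P ∧ b < o' ∧ o' ≤ o ∧ o' ≤ t := by
        rcases le_total o t with h' | h'
        · exact ⟨o, ho, h, le_rfl, h'⟩
        · exact ⟨t, htP, hbt, h', le_rfl⟩
      have hoI : o' ∈ Icc s t := ⟨hbI.1.trans hbo'.le, hot'⟩
      obtain ⟨c, hc1, hc2, hc3, hc4⟩ := gap_gt P o' b hbo' ho' hbP
      have hck := hsub c hc3 (by rw [abs_lt] at hod ⊢; constructor <;> linarith)
      rcases hc4 with rfl | ⟨hc4, hc5⟩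
      · exact hGO k c hck (hPO c hoI ho')
      · refine j1 k c hck o' hc4 fun x hx => hPO x ⟨?_, hx.2.le.trans hot'⟩ (hc5 hx)
        linarith [hx.1, hbI.1]
  · simp only [Sum.elim_inr] at hsub hbk
    have hbO := hHI k b hbk
    have hbP : b ∉ P := fun h => hbO (hPI b hbI h)
    have hbs : s < b := lt_of_le_of_ne hbI.1 (fun h => hbP (h ▸ hsP))
    obtain ⟨o, ho, hod⟩ := Metric.mem_closure_iff.1 hb2.1 ρ hρ
    rw [Real.dist_eq] at hod
    have hob : o ≠ b := fun h => hbP (h ▸ ho)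
    rcases lt_or_gt_of_ne hob with h | h
    · obtain ⟨o', ho', hbo', hoo', hot'⟩ : ∃ o', o' ∈ P ∧ o' < b ∧ o ≤ o' ∧ s ≤ o' := by
        rcases le_total s o with h' | h'
        · exact ⟨o, ho, h, le_rfl, h'⟩
        · exact ⟨s, hsP, hbs, h', le_rfl⟩
      have hoI : o' ∈ Icc s t := ⟨hot', hbo'.le.trans hbI.2⟩
      obtain ⟨c, hc1, hc2, hc3, hc4⟩ := gap_lt Pᶜ o' b hbo' (by simpa using ho') hbP
      rw [frontier_compl] at hc3
      rw [compl_compl] at hc4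
      have hck := hsub c hc3 (by rw [abs_lt] at hod ⊢; constructor <;> linarith)
      rcases hc4 with rfl | ⟨hc4, hc5⟩
      · exact hHI k c hck (hPI c hoI ho')
      · refine j4 k c hck o' hc4 fun x hx => hPI x ⟨hot'.trans hx.1.le, ?_⟩ (hc5 hx)
        linarith [hx.2, hbI.2]
    · have hot : o ≤ t := by
        rcases ho with h' | h'
        · exact absurd h' (not_lt.2 (hbs.le.trans h.le))
        · exact h'.2.2
      have hoI : o ∈ Icc s t := ⟨hbs.le.trans h.le, hot⟩
      obtain ⟨c, hc1, hc2, hc3, hc4⟩ := gap_gt Pᶜ o b h (by simpa using ho) hbP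
      rw [frontier_compl] at hc3
      rw [compl_compl] at hc4
      have hck := hsub c hc3 (by rw [abs_lt] at hod ⊢; constructor <;> linarith)
      rcases hc4 with rfl | ⟨hc4, hc5⟩
      · exact hHI k c hck (hPI c hoI ho)
      · refine j3 k c hck o hc4 fun x hx => hPI x ⟨?_, hx.2.le.trans hot⟩ (hc5 hx)
        linarith [hx.1, hbI.1]

def lowDens {n : ℕ} (E : Set (Fin (n+1) → ℝ)) : Set (Fin (n+1) → ℝ) :=
  {x | ∀ ε : ℝ, 0 < ε → ∃ r0 : ℝ, 0 < r0 ∧ ∀ r, 0 < r → r < r0 →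
    volume (ball x r ∩ E) ≤ ENNReal.ofReal (ε * r ^ (n+1))}

def gd {n : ℕ} (E : Set (Fin (n+1) → ℝ)) (k : ℕ) : Set (Fin (n+1) → ℝ) :=
  {x | ∀ r : ℝ, 0 < r → r < 1 / ((k : ℝ) + 1) →
    volume (ball x r ∩ E) ≤ ENNReal.ofReal (1 / (8 * 3 ^ n) * r ^ (n+1))}

lemma lowDens_sub_gd {n : ℕ} (E : Set (Fin (n+1) → ℝ)) : lowDens E ⊆ ⋃ k, gd E k := by
  intro x hx
  obtain ⟨r0, hr0, h⟩ := hx (1 / (8 * 3 ^ n)) (by positivity)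
  obtain ⟨k, hk⟩ := exists_nat_one_div_lt hr0
  exact mem_iUnion.2 ⟨k, fun r h1 h2 => h r h1 (h2.trans hk)⟩

lemma gd_not_lowDens {n : ℕ} (E : Set (Fin (n+1) → ℝ)) (k : ℕ) (x) (hx : x ∈ gd E k) :
    x ∉ lowDens Eᶜ := by
  intro hx'
  obtain ⟨r0, hr0, h⟩ := hx' 1 (by positivity)
  set r := min r0 (1 / ((k : ℝ) + 1)) / 2 with hr
  have hm : 0 < min r0 (1 / ((k : ℝ) + 1)) := lt_min hr0 (by positivity)
  have hrpos : 0 < r := by positivity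
  have h1 := hx r hrpos (by have := min_le_right r0 (1 / ((k : ℝ) + 1)); linarith)
  have h2 := h r hrpos (by have := min_le_left r0 (1 / ((k : ℝ) + 1)); linarith)
  have h3 : volume (ball x r) ≤ volume (ball x r ∩ E) + volume (ball x r ∩ Eᶜ) := by
    refine (measure_mono ?_).trans (measure_union_le _ _)
    rw [inter_union_compl]
  rw [Real.volume_pi_ball _ hrpos, Fintype.card_fin] at h3
  have h4 := h3.trans (add_le_add h1 h2)
  rw [← ENNReal.ofReal_add (by positivity) (by positivity),
    ENNReal.ofReal_le_ofReal_iff (by positivity), mul_pow, ← add_mul] at h4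
  have h5 : (2:ℝ) ^ (n+1) ≤ 1 / (8 * 3 ^ n) + 1 := le_of_mul_le_mul_right h4 (by positivity)
  have h6 : (1:ℝ) / (8 * 3 ^ n) ≤ 1 / 8 := by
    apply one_div_le_one_div_of_le (by norm_num)
    have : (1:ℝ) ≤ 3 ^ n := one_le_pow₀ (by norm_num)
    linarith
  have h7 : (1:ℝ) ≤ 2 ^ n := one_le_pow₀ (by norm_num)
  rw [pow_succ] at h5
  linarith

lemma gd_closed {n : ℕ} (E : Set (Fin (n+1) → ℝ)) (k : ℕ) : IsClosed (gd E k) := by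
  rw [← isSeqClosed_iff_isClosed]
  intro u x hu hx r hr hrk
  have key : ∀ᶠ s in nhdsWithin r (Ioi r),
      volume (ball x r ∩ E) ≤ ENNReal.ofReal (1 / (8 * 3 ^ n) * s ^ (n+1)) := by
    filter_upwards [Ioo_mem_nhdsGT hrk] with s hs
    have : ∀ᶠ i in atTop, dist (u i) x < s - r :=
      (Metric.tendsto_nhds.1 hx) _ (by linarith [hs.1])
    obtain ⟨i, hi⟩ := this.exists
    refine (measure_mono (inter_subset_inter_left _ (ball_subset_ball' ?_))).trans
      (hu i s (hr.trans hs.1) hs.2)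
    rw [dist_comm]; linarith
  have hc : Tendsto (fun s : ℝ => ENNReal.ofReal (1 / (8 * 3 ^ n) * s ^ (n+1)))
      (nhdsWithin r (Ioi r)) (nhds (ENNReal.ofReal (1 / (8 * 3 ^ n) * r ^ (n+1)))) := by
    apply Tendsto.mono_left _ nhdsWithin_le_nhds
    apply Continuous.tendsto
    exact ENNReal.continuous_ofReal.comp (by fun_prop)
  exact ge_of_tendsto hc key

lemma ae_lowDens {n : ℕ} (E : Set (Fin (n+1) → ℝ)) (hE : MeasurableSet E) :
    ∀ᵐ x, x ∈ E → x ∈ lowDens Eᶜ := by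
  filter_upwards [Besicovitch.ae_tendsto_measure_inter_div_of_measurableSet volume hE.compl]
    with x hx hxE ε hε
  rw [indicator_of_notMem (by simpa using hxE)] at hx
  have h1 : ∀ᶠ r in nhdsWithin (0:ℝ) (Ioi 0), volume (Eᶜ ∩ closedBall x r) /
      volume (closedBall x r) < ENNReal.ofReal (ε / 2 ^ (n+1)) :=
    hx.eventually_lt_const (by rw [ENNReal.ofReal_pos]; positivity)
  rw [eventually_nhdsWithin_iff, Metric.eventually_nhds_iff] at h1
  obtain ⟨r0, hr0, h⟩ := h1
  refine ⟨r0, hr0, fun r hr hrr => ?_⟩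
  have h2 := h (y := r) (by rw [Real.dist_eq, sub_zero, abs_of_pos hr]; exact hrr) hr
  rw [Real.volume_pi_closedBall _ hr.le, Fintype.card_fin,
    ENNReal.div_lt_iff (Or.inl (by rw [Ne, ENNReal.ofReal_eq_zero, not_le]; positivity))
      (Or.inl ENNReal.ofReal_ne_top), ← ENNReal.ofReal_mul (by positivity)] at h2
  have h3 : ε / 2 ^ (n+1) * (2 * r) ^ (n+1) = ε * r ^ (n+1) := by
    rw [mul_pow]; field_simp
  rw [h3] at h2
  refine (measure_mono ?_).trans h2.le
  rw [inter_comm]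
  exact inter_subset_inter_right _ ball_subset_closedBall

lemma null_lowDens {n : ℕ} (E : Set (Fin (n+1) → ℝ)) (hE : MeasurableSet E) :
    volume (lowDens E ∩ E) = 0 := by
  have := ae_lowDens E hE
  rw [ae_iff] at this
  refine measure_mono_null ?_ this
  rintro x ⟨hx1, hx2⟩ h
  obtain ⟨k', hk'⟩ := mem_iUnion.1 (lowDens_sub_gd _ hx1)
  exact gd_not_lowDens E k' x hk' (h hx2)

def ins {n : ℕ} (j : Fin (n+1)) (u : ℝ) (z : Fin n → ℝ) : Fin (n+1) → ℝ :=
  Fin.insertNth (α := fun _ => ℝ) j u z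

def pr {n : ℕ} (j : Fin (n+1)) (x : Fin (n+1) → ℝ) : Fin n → ℝ := fun k => x (j.succAbove k)

@[simp] lemma ins_self {n : ℕ} (j : Fin (n+1)) (u : ℝ) (z : Fin n → ℝ) : ins j u z j = u := by
  simp [ins]

@[simp] lemma ins_succAbove {n : ℕ} (j : Fin (n+1)) (u : ℝ) (z : Fin n → ℝ) (k : Fin n) :
    ins j u z (j.succAbove k) = z k := by
  simp [ins]

@[simp] lemma pr_ins {n : ℕ} (j : Fin (n+1)) (u : ℝ) (z : Fin n → ℝ) : pr j (ins j u z) = z := by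
  ext k; simp [pr]

lemma ins_pr {n : ℕ} (j : Fin (n+1)) (x : Fin (n+1) → ℝ) : ins j (x j) (pr j x) = x := by
  ext i
  rcases Fin.eq_self_or_eq_succAbove j i with rfl | ⟨k, rfl⟩
  · simp
  · simp [pr]

lemma dist_ins_lt {n : ℕ} (j : Fin (n+1)) (u v : ℝ) (z w : Fin n → ℝ) (r : ℝ) (hr : 0 < r)
    (h1 : |u - v| < r) (h2 : dist z w < r) : dist (ins j u z) (ins j v w) < r := by
  rw [dist_pi_lt_iff hr]
  intro i
  rcases Fin.eq_self_or_eq_succAbove j i with rfl | ⟨k, rfl⟩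
  · simpa [Real.dist_eq] using h1
  · simpa using (dist_pi_lt_iff hr).1 h2 k

lemma continuous_ins {n : ℕ} (j : Fin (n+1)) (z : Fin n → ℝ) : Continuous fun u => ins j u z := by
  rw [continuous_pi_iff]
  intro i
  rcases Fin.eq_self_or_eq_succAbove j i with rfl | ⟨k, rfl⟩
  · simpa using continuous_id'
  · simpa using continuous_const

lemma vol_cyl {n : ℕ} (j : Fin (n+1)) (T : Set ℝ) (S : Set (Fin n → ℝ)) :
    volume {x : Fin (n+1) → ℝ | x j ∈ T ∧ pr j x ∈ S} = volume T * volume S := by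
  have h := (volume_preserving_piFinSuccAbove (fun _ : Fin (n+1) => ℝ) j).measure_preimage_equiv
    (T ×ˢ S)
  rw [Measure.volume_eq_prod, Measure.prod_prod] at h
  rw [← h]
  rfl

def jmp {n : ℕ} (E : Set (Fin (n+1) → ℝ)) (j : Fin (n+1)) (σ : ℝ) (k m : ℕ) : Set (Fin n → ℝ) :=
  {z | ∃ u, ins j u z ∈ gd Eᶜ k ∧
    ∀ s, 0 < s → s < 1 / ((m : ℝ) + 1) → ins j (u + σ * s) z ∈ lowDens E}

lemma jmp_null {n : ℕ} (E : Set (Fin (n+1) → ℝ)) (hE : MeasurableSet E) (j : Fin (n+1)) (σ : ℝ)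
    (hσ : σ = 1 ∨ σ = -1) (k m : ℕ) : volume (jmp E j σ k m) = 0 := by
  have hσσ : σ * σ = 1 := by rcases hσ with rfl | rfl <;> norm_num
  have habs : ∀ x : ℝ, |σ * x| = |x| := by
    intro x; rcases hσ with rfl | rfl <;> simp
  set η : ℝ := 1 / (2 * ((m : ℝ) + 1)) with hη
  have hηpos : 0 < η := by positivity
  have hη2 : 1 / ((m : ℝ) + 1) = 2 * η := by rw [hη]; field_simp
  let S : ℤ → Set (Fin n → ℝ) := fun q => {z | ∃ u, ins j u z ∈ gd Eᶜ k ∧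
    (∀ s, 0 < s → s < 1 / ((m : ℝ) + 1) → ins j (u + σ * s) z ∈ lowDens E) ∧
    q * η ≤ σ * u ∧ σ * u < (q + 1) * η}
  have hsub : jmp E j σ k m ⊆ ⋃ q, S q := by
    rintro z ⟨u, h1, h2⟩
    refine mem_iUnion.2 ⟨⌊σ * u / η⌋, u, h1, h2, ?_, ?_⟩
    · rw [← le_div_iff₀ hηpos]; exact Int.floor_le _
    · rw [← div_lt_iff₀ hηpos]; exact Int.lt_floor_add_one _
  refine measure_mono_null hsub (measure_iUnion_null fun q => ?_)
  by_contra hne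
  have : NeBot (ae (volume.restrict (S q))) := by
    rw [ae_neBot]; intro h
    exact hne (Measure.restrict_eq_zero.1 h)
  obtain ⟨z, hz⟩ := (Besicovitch.ae_tendsto_measure_inter_div volume (S q)).exists
  have h1 : ∀ᶠ r in nhdsWithin (0:ℝ) (Ioi 0), ENNReal.ofReal (1/2) < volume (S q ∩ closedBall z r) /
      volume (closedBall z r) :=
    hz.eventually_const_lt (by rw [ENNReal.ofReal_lt_one]; norm_num)
  have h2 : ∀ᶠ r in nhdsWithin (0:ℝ) (Ioi 0), r ∈ Ioo 0 (min η (1 / (3 * ((k:ℝ) + 1)))) :=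
    Ioo_mem_nhdsGT (lt_min hηpos (by positivity))
  obtain ⟨r, hr1, hr⟩ := (h1.and h2).exists
  have hrpos := hr.1
  have hrη : r < η := hr.2.trans_le (min_le_left _ _)
  have hrk : 3 * r < 1 / ((k:ℝ) + 1) := by
    have := hr.2.trans_le (min_le_right _ _)
    have h3 : 1 / ((k:ℝ) + 1) = 3 * (1 / (3 * ((k:ℝ) + 1))) := by field_simp
    rw [h3]; linarith
  rw [Real.volume_pi_closedBall _ hrpos.le, Fintype.card_fin,
    ENNReal.lt_div_iff_mul_lt (Or.inr (by simp)) (Or.inr (by simp)), 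
    ← ENNReal.ofReal_mul (by positivity)] at hr1
  set A := S q ∩ closedBall z r with hA
  have hAne : A.Nonempty := by
    rw [nonempty_iff_ne_empty]; intro h
    rw [h] at hr1; simp at hr1
  choose! f hf1 hf2 hf3 hf4 using (fun (y : Fin n → ℝ) (hy : y ∈ S q) => hy)
  set V : Set ℝ := (fun y => σ * f y) '' A with hV
  have hVne : V.Nonempty := hAne.image _
  have hVb : BddAbove V := by
    refine ⟨(q+1) * η, ?_⟩
    rintro _ ⟨y, hy, rfl⟩
    exact (hf4 y hy.1).le
  set c := sSup V with hc
  have hcge : ∀ y ∈ A, σ * f y ≤ c := fun y hy => le_csSup hVb ⟨y, hy, rfl⟩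
  have hcle : c ≤ (q+1) * η := by
    refine csSup_le hVne ?_
    rintro _ ⟨y, hy, rfl⟩
    exact (hf4 y hy.1).le
  obtain ⟨_, ⟨y0, hy0, rfl⟩, hy0c⟩ := exists_lt_of_lt_csSup hVne (show c - r < sSup V by linarith)
  simp only at hy0c
  set T : Set ℝ := {s | σ * s ∈ Ioo c (c + r)} with hT
  have hTv : volume T = ENNReal.ofReal r := by
    rcases hσ with rfl | rfl
    · have : T = Ioo c (c+r) := by ext s; simp [hT]
      rw [this, Real.volume_Ioo]; congr 1; ring
    · have : T = Ioo (-(c+r)) (-c) := by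
        ext s; simp only [hT, mem_Ioo, mem_ofPred_eq]
        constructor <;> rintro ⟨h, h'⟩ <;> constructor <;> linarith
      rw [this, Real.volume_Ioo]; congr 1; ring
  have hcyl := vol_cyl j T A
  rw [hTv] at hcyl
  have hnull := null_lowDens E hE
  have hsub2 : {x : Fin (n+1) → ℝ | x j ∈ T ∧ pr j x ∈ A} ⊆
      (ball (ins j (f y0) y0) (3 * r) ∩ Eᶜ) ∪ (lowDens E ∩ E) := by
    rintro x ⟨hx1, hx2⟩
    rw [hT, mem_ofPred_eq] at hx1
    have hy := hx2
    set y := pr j x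
    have hxO : x ∈ lowDens E := by
      have h5 := hf2 y hy.1 (σ * x j - σ * f y) (by linarith [hcge y hy, hx1.1])
        (by rw [hη2]; linarith [hx1.2, hf3 y hy.1, hcle])
      have h6 : f y + σ * (σ * x j - σ * f y) = x j := by
        have : σ * (σ * x j - σ * f y) = (σ * σ) * (x j - f y) := by ring
        rw [this, hσσ]; ring
      rw [h6, ins_pr] at h5
      exact h5
    by_cases hxE : x ∈ E
    · exact Or.inr ⟨hxO, hxE⟩
    · refine Or.inl ⟨?_, hxE⟩
      rw [mem_ball, ← ins_pr j x]
      apply dist_ins_lt _ _ _ _ _ _ (by positivity)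
      · rw [← habs, mul_sub, abs_lt]
        have := hcge y0 hy0
        constructor <;> linarith [hx1.1, hx1.2]
      · have h7 := mem_closedBall.1 hy.2
        have h8 := mem_closedBall.1 hy0.2
        have := dist_triangle_right y y0 z
        linarith
  have h9 : ENNReal.ofReal r * volume A ≤ ENNReal.ofReal (1 / (8 * 3 ^ n) * (3 * r) ^ (n+1)) := by
    rw [← hcyl]
    refine (measure_mono hsub2).trans ((measure_union_le _ _).trans ?_)
    rw [hnull, add_zero]
    exact hf1 y0 hy0.1 (3 * r) (by positivity) hrk
  have h10 : ENNReal.ofReal r * ENNReal.ofReal (1 / 2 * (2 * r) ^ n) ≤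
      ENNReal.ofReal (1 / (8 * 3 ^ n) * (3 * r) ^ (n+1)) :=
    le_trans (by gcongr) h9
  rw [← ENNReal.ofReal_mul hrpos.le, ENNReal.ofReal_le_ofReal_iff (by positivity)] at h10
  have h11 : r * (1 / 2 * (2 * r) ^ n) = (1/2 * 2 ^ n) * r ^ (n+1) := by rw [mul_pow]; ring
  have h12 : 1 / (8 * 3 ^ n) * (3 * r) ^ (n+1) = 3 / 8 * r ^ (n+1) := by
    rw [mul_pow, pow_succ 3]; field_simp
  rw [h11, h12] at h10
  have h13 := le_of_mul_le_mul_right h10 (by positivity)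
  have h14 : (1:ℝ) ≤ 2 ^ n := one_le_pow₀ (by norm_num)
  linarith

def lineNull {n : ℕ} (E : Set (Fin (n+1) → ℝ)) (j : Fin (n+1)) : Set (Fin n → ℝ) :=
  ⋃ k, ⋃ m, (jmp E j 1 k m ∪ jmp E j (-1) k m) ∪ (jmp Eᶜ j 1 k m ∪ jmp Eᶜ j (-1) k m)

lemma lineNull_null {n : ℕ} (E : Set (Fin (n+1) → ℝ)) (hE : MeasurableSet E) (j : Fin (n+1)) :
    volume (lineNull E j) = 0 := by
  refine measure_iUnion_null fun k => measure_iUnion_null fun m => ?_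
  refine measure_union_null (measure_union_null ?_ ?_) (measure_union_null ?_ ?_)
  · exact jmp_null E hE j 1 (Or.inl rfl) k m
  · exact jmp_null E hE j (-1) (Or.inr rfl) k m
  · exact jmp_null _ hE.compl j 1 (Or.inl rfl) k m
  · exact jmp_null _ hE.compl j (-1) (Or.inr rfl) k m

lemma jump_pos {n : ℕ} (E : Set (Fin (n+1) → ℝ)) (j : Fin (n+1)) (z : Fin n → ℝ)
    (hz : ∀ k m, z ∉ jmp E j 1 k m) (k : ℕ) (b : ℝ) (hb : ins j b z ∈ gd Eᶜ k) (c : ℝ) (hbc : b < c) :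
    ¬ Ioo b c ⊆ {u | ins j u z ∈ lowDens E} := by
  intro h
  obtain ⟨m, hm⟩ := exists_nat_one_div_lt (sub_pos.2 hbc)
  refine hz k m ⟨b, hb, fun s hs hs' => h ⟨?_, ?_⟩⟩ <;> linarith

lemma jump_neg {n : ℕ} (E : Set (Fin (n+1) → ℝ)) (j : Fin (n+1)) (z : Fin n → ℝ)
    (hz : ∀ k m, z ∉ jmp E j (-1) k m) (k : ℕ) (b : ℝ) (hb : ins j b z ∈ gd Eᶜ k) (c : ℝ)
    (hbc : c < b) :
    ¬ Ioo c b ⊆ {u | ins j u z ∈ lowDens E} := by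
  intro h
  obtain ⟨m, hm⟩ := exists_nat_one_div_lt (sub_pos.2 hbc)
  refine hz k m ⟨b, hb, fun s hs hs' => h ⟨?_, ?_⟩⟩ <;> linarith

lemma line_lt {n : ℕ} (E : Set (Fin (n+1) → ℝ)) (j : Fin (n+1)) (z : Fin n → ℝ)
    (h1 : ∀ k m, z ∉ jmp E j 1 k m) (h2 : ∀ k m, z ∉ jmp E j (-1) k m)
    (h3 : ∀ k m, z ∉ jmp Eᶜ j 1 k m) (h4 : ∀ k m, z ∉ jmp Eᶜ j (-1) k m)
    (s t : ℝ) (hst : s < t) (hs : ins j s z ∈ lowDens Eᶜ) (ht : ins j t z ∈ lowDens E)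
    (hcov : ∀ u ∈ Icc s t, ins j u z ∈ lowDens E ∨ ins j u z ∈ lowDens Eᶜ) : False := by
  have hc := continuous_ins j z
  refine oneD {u | ins j u z ∈ lowDens Eᶜ} {u | ins j u z ∈ lowDens E}
    (fun k => {u | ins j u z ∈ gd Eᶜ k}) (fun k => {u | ins j u z ∈ gd E k})
    (fun k => (gd_closed _ k).preimage hc) (fun k => (gd_closed _ k).preimage hc)
    ?_ ?_ ?_ ?_ s t hst hs ht ?_ ?_ ?_ ?_ ?_
  · intro u hu
    obtain ⟨k, hk⟩ := mem_iUnion.1 (lowDens_sub_gd _ hu)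
    exact mem_iUnion.2 ⟨k, hk⟩
  · intro u hu
    obtain ⟨k, hk⟩ := mem_iUnion.1 (lowDens_sub_gd _ hu)
    exact mem_iUnion.2 ⟨k, hk⟩
  · intro k x hx
    have := gd_not_lowDens _ k _ hx
    rw [compl_compl] at this
    exact this
  · intro k x hx
    exact gd_not_lowDens _ k _ hx
  · intro u hu
    exact (hcov u hu).symm
  · exact fun k b hb c hbc => jump_pos E j z h1 k b hb c hbc
  · exact fun k b hb c hbc => jump_neg E j z h2 k b hb c hbc
  · exact fun k b hb c hbc => jump_pos Eᶜ j z h3 k b (by rw [compl_compl]; exact hb) c hbc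
  · exact fun k b hb c hbc => jump_neg Eᶜ j z h4 k b (by rw [compl_compl]; exact hb) c hbc

lemma line {n : ℕ} (E : Set (Fin (n+1) → ℝ)) (j : Fin (n+1)) (z : Fin n → ℝ)
    (hz : z ∉ lineNull E j)
    (s t : ℝ) (hs : ins j s z ∈ lowDens Eᶜ) (ht : ins j t z ∈ lowDens E)
    (hcov : ∀ u ∈ uIcc s t, ins j u z ∈ lowDens E ∨ ins j u z ∈ lowDens Eᶜ) : False := by
  simp only [lineNull, mem_iUnion, mem_union, not_exists, not_or] at hz
  rcases lt_trichotomy s t with h | h | h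
  · rw [uIcc_of_le h.le] at hcov
    exact line_lt E j z (fun k m => (hz k m).1.1) (fun k m => (hz k m).1.2)
      (fun k m => (hz k m).2.1) (fun k m => (hz k m).2.2) s t h hs ht hcov
  · subst h
    obtain ⟨k, hk⟩ := mem_iUnion.1 (lowDens_sub_gd _ ht)
    exact gd_not_lowDens _ k _ hk hs
  · rw [uIcc_of_ge h.le] at hcov
    refine line_lt Eᶜ j z (fun k m => (hz k m).2.1) (fun k m => (hz k m).2.2)
      (fun k m => ?_) (fun k m => ?_) t s h (by rw [compl_compl]; exact ht) hs
      (fun u hu => by rw [compl_compl]; exact (hcov u hu).symm)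
    · rw [compl_compl]; exact (hz k m).1.1
    · rw [compl_compl]; exact (hz k m).1.2

def oc {n : ℕ} (a : Fin n → ℝ) (l : ℝ) : Set (Fin n → ℝ) :=
  {x | ∀ i, a i < x i ∧ x i < a i + l}

lemma oc_eq {n : ℕ} (a : Fin n → ℝ) (l : ℝ) :
    oc a l = univ.pi fun i => Ioo (a i) (a i + l) := by
  ext x; simp [oc]

lemma vol_oc {n : ℕ} (a : Fin n → ℝ) (l : ℝ) (hl : 0 < l) :
    volume (oc a l) = ENNReal.ofReal (l ^ n) := by
  rw [oc_eq, volume_pi_pi]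
  simp [ENNReal.ofReal_pow hl.le]

def bad {n : ℕ} (E M : Set (Fin (n+1) → ℝ)) (a : Fin (n+1) → ℝ) (l : ℝ) (j : Fin (n+1)) :
    Set (Fin (n+1) → ℝ) :=
  {x | x ∈ oc a l ∧ (pr j x ∈ pr j '' (M ∩ oc a l) ∪ lineNull E j)}

lemma vol_bad {n : ℕ} (E M : Set (Fin (n+1) → ℝ)) (hE : MeasurableSet E)
    (a : Fin (n+1) → ℝ) (l : ℝ) (j : Fin (n+1)) (h : ℝ≥0∞)
    (hh : volume (pr j '' (M ∩ oc a l)) ≤ h) :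
    volume (bad E M a l j) ≤ ENNReal.ofReal l * h := by
  have h1 := vol_cyl j (Ioo (a j) (a j + l)) (pr j '' (M ∩ oc a l) ∪ lineNull E j)
  have h2 : volume (pr j '' (M ∩ oc a l) ∪ lineNull E j) ≤ h := by
    refine (measure_union_le _ _).trans ?_
    rw [lineNull_null E hE j, add_zero]; exact hh
  rw [Real.volume_Ioo, add_sub_cancel_left] at h1
  calc volume (bad E M a l j) ≤ volume {x : Fin (n+1) → ℝ | x j ∈ Ioo (a j) (a j + l) ∧
        pr j x ∈ pr j '' (M ∩ oc a l) ∪ lineNull E j} :=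
        measure_mono (fun x hx => ⟨hx.1 j, hx.2⟩)
    _ = _ := h1
    _ ≤ _ := by gcongr

lemma step {n : ℕ} (E M : Set (Fin (n+1) → ℝ)) (hM : ∀ x, x ∉ M → x ∈ lowDens E ∨ x ∈ lowDens Eᶜ)
    (a : Fin (n+1) → ℝ) (l : ℝ) (j : Fin (n+1)) (x y : Fin (n+1) → ℝ)
    (hx : x ∈ oc a l) (hxb : x ∉ bad E M a l j) (hxy : pr j y = pr j x)
    (hy1 : a j ≤ y j) (hy2 : y j ≤ a j + l) (hy : y ∈ lowDens E) : x ∈ lowDens E := by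
  have hnb : ¬ (pr j x ∈ pr j '' (M ∩ oc a l) ∪ lineNull E j) := fun h => hxb ⟨hx, h⟩
  rw [mem_union, not_or] at hnb
  have hMM : ∀ u, a j < u → u < a j + l →
      ins j u (pr j x) ∈ lowDens E ∨ ins j u (pr j x) ∈ lowDens Eᶜ := by
    intro u hu1 hu2
    apply hM
    intro hin
    refine hnb.1 ⟨_, ⟨hin, ?_⟩, pr_ins _ _ _⟩
    intro i
    rcases Fin.eq_self_or_eq_succAbove j i with rfl | ⟨k, rfl⟩
    · simpa using ⟨hu1, hu2⟩
    · simpa [pr] using hx (j.succAbove k)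
  have hxx := hMM (x j) (hx j).1 (hx j).2
  rw [ins_pr] at hxx
  rcases hxx with h | h
  · exact h
  · exfalso
    have hyy : ins j (y j) (pr j x) ∈ lowDens E := by rw [← hxy, ins_pr]; exact hy
    refine line E j (pr j x) hnb.2 (x j) (y j) (by rw [ins_pr]; exact h) hyy fun u hu => ?_
    by_cases huy : u = y j
    · left; rw [huy]; exact hyy
    · have hxj := hx j
      rcases mem_uIcc.1 hu with h' | h'
      · exact hMM u (by linarith) (by
          have := lt_of_le_of_ne h'.2 huy; linarith)
      · exact hMM u (by
          have := lt_of_le_of_ne h'.1 (Ne.symm huy); linarith) (by linarith)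

def mix {n : ℕ} (k : ℕ) (w x : Fin n → ℝ) : Fin n → ℝ := fun i => if i.val < k then x i else w i

lemma mix_oc {n : ℕ} (a : Fin n → ℝ) (l : ℝ) (k : ℕ) (w x) (hw : w ∈ oc a l) (hx : x ∈ oc a l) :
    mix k w x ∈ oc a l := by
  intro i
  unfold mix
  split_ifs
  · exact hx i
  · exact hw i

lemma mix_mp {n : ℕ} (k : ℕ) : MeasurePreserving
    (fun p : (Fin n → ℝ) × (Fin n → ℝ) => (mix k p.1 p.2, mix k p.2 p.1)) volume volume := by
  have h1 := volume_measurePreserving_arrowProdEquivProdArrow ℝ ℝ (Fin n)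
  have h2 : MeasurePreserving (fun (a : Fin n → ℝ × ℝ) (i : Fin n) =>
      (if i.val < k then Prod.swap else id : ℝ × ℝ → ℝ × ℝ) (a i)) volume volume := by
    apply volume_preserving_pi
    intro i
    split_ifs
    · exact Measure.measurePreserving_swap
    · exact MeasurePreserving.id _
  have h3 := h1.comp (h2.comp h1.symm)
  convert! h3 using 1
  ext ⟨w, x⟩ i
  · simp only [Function.comp, MeasurableEquiv.arrowProdEquivProdArrow, mix]
    by_cases hi : i.val < k <;> simp [hi, Equiv.arrowProdEquivProdArrow]
  · simp only [Function.comp, MeasurableEquiv.arrowProdEquivProdArrow, mix]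
    by_cases hi : i.val < k <;> simp [hi, Equiv.arrowProdEquivProdArrow]

lemma pair {n : ℕ} (E M : Set (Fin (n+1) → ℝ)) (hE : MeasurableSet E)
    (hM : ∀ x, x ∉ M → x ∈ lowDens E ∨ x ∈ lowDens Eᶜ)
    (a : Fin (n+1) → ℝ) (l : ℝ) (hl : 0 < l) (h : ℝ≥0∞)
    (hh : ∀ j, volume (pr j '' (M ∩ oc a l)) ≤ h) :
    volume (oc a l ∩ Eᶜ) * volume (oc a l ∩ E) ≤
      (n + 1 : ℕ) * ((ENNReal.ofReal l * h) * ENNReal.ofReal (l ^ (n+1))) := by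
  have hA1 : volume (oc a l ∩ Eᶜ) ≤ volume (oc a l ∩ lowDens E) := by
    apply measure_mono_ae
    filter_upwards [ae_lowDens _ hE.compl] with x hx hx'
    rw [compl_compl] at hx
    exact ⟨hx'.1, hx hx'.2⟩
  have hA2 : volume (oc a l ∩ E) ≤ volume (oc a l ∩ lowDens Eᶜ) := by
    apply measure_mono_ae
    filter_upwards [ae_lowDens _ hE] with x hx hx'
    exact ⟨hx'.1, hx hx'.2⟩
  let R : Fin (n+1) → Set ((Fin (n+1) → ℝ) × (Fin (n+1) → ℝ)) := fun j =>
    (fun p => (mix j.val p.1 p.2, mix j.val p.2 p.1)) ⁻¹' (bad E M a l j ×ˢ oc a l)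
  have hsub : (oc a l ∩ lowDens E) ×ˢ (oc a l ∩ lowDens Eᶜ) ⊆ ⋃ j, R j := by
    rintro ⟨w, x⟩ ⟨⟨hw1, hw2⟩, ⟨hx1, hx2⟩⟩
    simp only at hw1 hw2 hx1 hx2
    by_contra hcon
    simp only [mem_iUnion, not_exists] at hcon
    have hnb : ∀ j : Fin (n+1), mix j.val w x ∉ bad E M a l j := by
      intro j hj
      exact hcon j ⟨hj, mix_oc a l _ x w hx1 hw1⟩
    have hnb2 : ∀ j : Fin (n+1), mix (j.val + 1) w x ∉ bad E M a l j := by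
      intro j hj
      refine hnb j ⟨mix_oc a l _ w x hw1 hx1, ?_⟩
      have : pr j (mix j.val w x) = pr j (mix (j.val + 1) w x) := by
        ext i
        simp only [pr, mix]
        have : (j.succAbove i).val ≠ j.val := fun h => Fin.succAbove_ne j i (Fin.ext h)
        congr 1
        simp only [eq_iff_iff]
        omega
      rw [this]; exact hj.2
    have hind : ∀ k : ℕ, k ≤ n + 1 → mix k w x ∈ lowDens E := by
      intro k
      induction k with
      | zero => intro _; have : mix 0 w x = w := by
                  ext i; simp [mix]
                rw [this]; exact hw2
      | succ k ih =>
        intro hk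
        have hik := ih (by omega)
        let j : Fin (n+1) := ⟨k, by omega⟩
        have hmk := mix_oc a l k w x hw1 hx1 j
        refine step E M hM a l j (mix (k+1) w x) (mix k w x) (mix_oc a l _ w x hw1 hx1)
          (hnb2 j) ?_ hmk.1.le hmk.2.le hik
        ext i
        simp only [pr, mix]
        have : (j.succAbove i).val ≠ j.val := fun h => Fin.succAbove_ne j i (Fin.ext h)
        have hjk : j.val = k := rfl
        congr 1
        simp only [eq_iff_iff]
        omega
    have hfin := hind (n+1) le_rfl
    have : mix (n+1) w x = x := by
      ext i; simp [mix, i.isLt]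
    rw [this] at hfin
    obtain ⟨k, hk⟩ := mem_iUnion.1 (lowDens_sub_gd _ hfin)
    exact gd_not_lowDens _ k _ hk hx2
  calc volume (oc a l ∩ Eᶜ) * volume (oc a l ∩ E)
      ≤ volume (oc a l ∩ lowDens E) * volume (oc a l ∩ lowDens Eᶜ) := by gcongr
    _ = volume ((oc a l ∩ lowDens E) ×ˢ (oc a l ∩ lowDens Eᶜ)) := by
        rw [Measure.volume_eq_prod, Measure.prod_prod]
    _ ≤ volume (⋃ j, R j) := measure_mono hsub
    _ ≤ ∑ j, volume (R j) := measure_iUnion_fintype_le _ _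
    _ ≤ ∑ j : Fin (n+1), (ENNReal.ofReal l * h) * ENNReal.ofReal (l ^ (n+1)) := by
        apply Finset.sum_le_sum
        intro j _
        refine ((mix_mp j.val).measure_preimage_le _).trans ?_
        rw [Measure.volume_eq_prod, Measure.prod_prod, vol_oc a l hl]
        gcongr
        exact vol_bad E M hE a l j h (hh j)
    _ = _ := by simp

lemma oc_ae {n : ℕ} (a : Fin n → ℝ) (l : ℝ) :
    volume ({x : Fin n → ℝ | ∀ i, a i ≤ x i ∧ x i ≤ a i + l} \ oc a l) = 0 := by
  have h := Measure.univ_pi_Ioo_ae_eq_Icc (μ := fun _ : Fin n => (volume : Measure ℝ))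
    (f := a) (g := fun i => a i + l)
  have h2 := (ae_le_set.1 h.symm.le)
  rw [← oc_eq] at h2
  convert! h2 using 3
  ext x; simp [Pi.le_def, forall_and]

lemma trace {n : ℕ} (E M : Set (Fin (n+1) → ℝ)) (hE : MeasurableSet E)
    (hM : ∀ x, x ∉ M → x ∈ lowDens E ∨ x ∈ lowDens Eᶜ)
    (a : Fin (n+1) → ℝ) (l : ℝ) (h : ℝ≥0∞)
    (j : Fin (n+1)) (hh : volume (pr j '' (M ∩ oc a l)) ≤ h) (Y : Set (Fin (n+1) → ℝ))
    (hY : ∀ y ∈ Y, y ∈ lowDens E ∧ ∀ i, a i ≤ y i ∧ y i ≤ a i + l) :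
    ENNReal.ofReal l * volume (pr j '' Y) ≤ ENNReal.ofReal l * h + volume (oc a l ∩ Eᶜ) := by
  have h1 := vol_cyl j (Ioo (a j) (a j + l)) (pr j '' Y)
  rw [Real.volume_Ioo, add_sub_cancel_left] at h1
  rw [← h1]
  have hsub : {x : Fin (n+1) → ℝ | x j ∈ Ioo (a j) (a j + l) ∧ pr j x ∈ pr j '' Y} ⊆
      (bad E M a l j ∪ (oc a l ∩ Eᶜ)) ∪ ((lowDens E ∩ E) ∪
        ({x : Fin (n+1) → ℝ | ∀ i, a i ≤ x i ∧ x i ≤ a i + l} \ oc a l)) := by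
    rintro x ⟨hx1, ⟨y, hyY, hyx⟩⟩
    obtain ⟨hy1, hy2⟩ := hY y hyY
    by_cases hxo : x ∈ oc a l
    · by_cases hxb : x ∈ bad E M a l j
      · exact Or.inl (Or.inl hxb)
      · have := step E M hM a l j x y hxo hxb hyx (hy2 j).1 (hy2 j).2 hy1
        by_cases hxE : x ∈ E
        · exact Or.inr (Or.inl ⟨this, hxE⟩)
        · exact Or.inl (Or.inr ⟨hxo, hxE⟩)
    · refine Or.inr (Or.inr ⟨fun i => ?_, hxo⟩)
      rcases Fin.eq_self_or_eq_succAbove j i with rfl | ⟨k, rfl⟩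
      · exact ⟨hx1.1.le, hx1.2.le⟩
      · have : x (j.succAbove k) = y (j.succAbove k) := (congrFun hyx k).symm
        rw [this]; exact hy2 _
  refine (measure_mono hsub).trans ((measure_union_le _ _).trans ?_)
  rw [measure_union_null (null_lowDens E hE) (oc_ae a l), add_zero]
  refine (measure_union_le _ _).trans ?_
  gcongr
  exact vol_bad E M hE a l j h hh

lemma half_aux (P X Y : ℝ≥0∞) (N : ℕ) (c : ℝ) (hc : 0 < c) (hP : ENNReal.ofReal (c / 2) ≤ P)
    (h : P * X ≤ N * (Y * ENNReal.ofReal c)) : X ≤ 2 * N * Y := by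
  have h1 : ENNReal.ofReal (c/2) * X ≤ ENNReal.ofReal (c/2) * (2 * N * Y) := by
    have h2 : ENNReal.ofReal c = ENNReal.ofReal (c/2) * 2 := by
      rw [← ENNReal.ofReal_ofNat 2, ← ENNReal.ofReal_mul (by positivity)]; congr 1; simp
    calc ENNReal.ofReal (c/2) * X ≤ P * X := by gcongr
      _ ≤ _ := h
      _ = _ := by rw [h2]; ring
  exact (ENNReal.mul_le_mul_iff_right (by rw [Ne, ENNReal.ofReal_eq_zero]; linarith)
    ENNReal.ofReal_ne_top).1 h1

lemma exists_N (n : ℕ) (lam : ℝ) (h0 : 0 < lam) (h1 : lam ≤ 1/2) :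
    ∃ N : ℕ, 0 < N ∧ 2 * lam * (N:ℝ) ^ (n+1) ≤ 1 ∧
      1 / ((N:ℝ) * lam) ≤ 4 * lam ^ (-(n:ℝ) / ((n:ℝ)+1)) := by
  set y : ℝ := (2 * lam) ^ (-(1:ℝ) / ((n:ℝ)+1)) with hy
  have hypos : 0 < y := by positivity
  have hy1 : 1 ≤ y := by
    apply Real.one_le_rpow_of_pos_of_le_one_of_nonpos (by positivity) (by linarith)
    rw [neg_div]; simp; positivity
  have hyp : y ^ (n+1) = 1 / (2 * lam) := by
    rw [hy, ← Real.rpow_natCast, ← Real.rpow_mul (by positivity)]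
    have : -(1:ℝ) / ((n:ℝ)+1) * ((n+1 : ℕ):ℝ) = -1 := by push_cast; field_simp
    rw [this, Real.rpow_neg_one, one_div]
  have hNle : ((⌊y⌋₊ : ℕ) : ℝ) ≤ y := Nat.floor_le hypos.le
  have hN1 : 1 ≤ ⌊y⌋₊ := Nat.one_le_floor_iff _ |>.2 hy1
  have hN1' : (1:ℝ) ≤ (⌊y⌋₊ : ℝ) := by exact_mod_cast hN1
  have hlt := Nat.lt_floor_add_one y
  refine ⟨⌊y⌋₊, hN1, ?_, ?_⟩
  · calc 2 * lam * ((⌊y⌋₊ : ℕ):ℝ) ^ (n+1) ≤ 2 * lam * y ^ (n+1) := by gcongr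
      _ = 1 := by rw [hyp]; field_simp
  · have h2 : y / 2 ≤ (⌊y⌋₊ : ℝ) := by linarith
    have h3 : 1 / ((⌊y⌋₊ : ℝ) * lam) ≤ 1 / (y / 2 * lam) := by gcongr
    refine h3.trans ?_
    have h4 : 1 / (y / 2 * lam) = 2 * (2 * lam) ^ ((1:ℝ) / ((n:ℝ)+1)) / lam := by
      rw [hy, neg_div, Real.rpow_neg (by positivity)]
      field_simp
    rw [h4, Real.mul_rpow (by norm_num) h0.le]
    have h5 : (2:ℝ) ^ ((1:ℝ) / ((n:ℝ)+1)) ≤ 2 := by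
      calc (2:ℝ) ^ ((1:ℝ) / ((n:ℝ)+1)) ≤ 2 ^ (1:ℝ) := by
            apply Real.rpow_le_rpow_of_exponent_le (by norm_num)
            rw [div_le_one (by positivity)]
            linarith [Nat.cast_nonneg (α := ℝ) n]
        _ = 2 := by simp
    have h6 : lam ^ (-(n:ℝ) / ((n:ℝ)+1)) = lam ^ ((1:ℝ) / ((n:ℝ)+1)) / lam := by
      rw [← Real.rpow_sub_one h0.ne']
      congr 1
      field_simp
      ring
    rw [h6]
    have h7 : 0 ≤ lam ^ ((1:ℝ) / ((n:ℝ)+1)) / lam := by positivity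
    calc 2 * (2 ^ ((1:ℝ) / ((n:ℝ)+1)) * lam ^ ((1:ℝ) / ((n:ℝ)+1))) / lam
        = 2 * 2 ^ ((1:ℝ) / ((n:ℝ)+1)) * (lam ^ ((1:ℝ) / ((n:ℝ)+1)) / lam) := by ring
      _ ≤ 2 * 2 * (lam ^ ((1:ℝ) / ((n:ℝ)+1)) / lam) := by gcongr
      _ = _ := by ring

def subA {n : ℕ} (a : Fin n → ℝ) (δ : ℝ) {N : ℕ} (k : Fin n → Fin N) : Fin n → ℝ :=
  fun i => a i + δ * ((k i).val : ℝ)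

lemma sub_disj {n : ℕ} (a : Fin n → ℝ) (δ : ℝ) (hδ : 0 < δ) (N : ℕ) :
    Pairwise (Function.onFun Disjoint fun k : Fin n → Fin N => oc (subA a δ k) δ) := by
  have key : ∀ (p q : ℕ) (b x : ℝ), p < q → x < b + δ * p + δ → b + δ * q < x → False := by
    intro p q b x hpq h1 h2
    have : (p:ℝ) + 1 ≤ q := by exact_mod_cast hpq
    nlinarith
  intro k k' hkk
  rw [Function.onFun, Set.disjoint_left]
  intro x hx hx'
  apply hkk
  ext i
  by_contra hne
  have h1 := hx i
  have h2 := hx' i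
  simp only [subA] at h1 h2
  rcases lt_or_gt_of_ne hne with h | h
  · exact key _ _ _ _ h h1.2 h2.1
  · exact key _ _ _ _ h h2.2 h1.1

lemma subcube_sub {n : ℕ} (a : Fin n → ℝ) (δ : ℝ) (hδ : 0 < δ) (N : ℕ) (k : Fin n → Fin N) :
    oc (subA a δ k) δ ⊆ oc a (N * δ) := by
  intro x hx i
  have h1 := hx i
  simp only [subA] at h1
  have h2 : ((k i).val : ℝ) + 1 ≤ N := by exact_mod_cast (k i).isLt
  have h3 : (0:ℝ) ≤ ((k i).val : ℝ) := Nat.cast_nonneg _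
  constructor <;> nlinarith

lemma sub_cover {n : ℕ} (a : Fin n → ℝ) (δ : ℝ) (hδ : 0 < δ) (N : ℕ) (E : Set (Fin n → ℝ)) :
    volume (oc a (N * δ) ∩ E) ≤ ∑ k : Fin n → Fin N, volume (oc (subA a δ k) δ ∩ E) := by
  have hsub : oc a (N * δ) ∩ E ⊆ (⋃ k : Fin n → Fin N, oc (subA a δ k) δ ∩ E) ∪
      ⋃ k : Fin n → Fin N, ({x : Fin n → ℝ | ∀ i, subA a δ k i ≤ x i ∧ x i ≤ subA a δ k i + δ} \
        oc (subA a δ k) δ) := by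
    rintro x ⟨hx, hxE⟩
    have hpos : ∀ i, 0 ≤ (x i - a i) / δ := fun i =>
      div_nonneg (by linarith [(hx i).1]) hδ.le
    have hlt : ∀ i, ⌊(x i - a i) / δ⌋₊ < N := by
      intro i
      rw [Nat.floor_lt (hpos i), div_lt_iff₀ hδ]
      linarith [(hx i).2]
    let k : Fin n → Fin N := fun i => ⟨⌊(x i - a i) / δ⌋₊, hlt i⟩
    have hcl : ∀ i, subA a δ k i ≤ x i ∧ x i ≤ subA a δ k i + δ := by
      intro i
      have h1 := Nat.floor_le (hpos i)
      have h2 := (Nat.lt_floor_add_one ((x i - a i) / δ)).le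
      rw [le_div_iff₀ hδ] at h1
      rw [div_le_iff₀ hδ] at h2
      simp only [subA, k]
      constructor <;> nlinarith
    by_cases hxo : x ∈ oc (subA a δ k) δ
    · exact Or.inl (mem_iUnion.2 ⟨k, hxo, hxE⟩)
    · exact Or.inr (mem_iUnion.2 ⟨k, hcl, hxo⟩)
  refine (measure_mono hsub).trans ((measure_union_le _ _).trans ?_)
  rw [measure_iUnion_null (fun k => oc_ae _ _), add_zero]
  exact measure_iUnion_fintype_le _ _

lemma vol_split {n : ℕ} (a : Fin n → ℝ) (l : ℝ) (hl : 0 < l) (E : Set (Fin n → ℝ)) 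
    (h : volume (oc a l ∩ E) ≤ ENNReal.ofReal (l ^ n / 2)) :
    ENNReal.ofReal (l ^ n / 2) ≤ volume (oc a l ∩ Eᶜ) := by
  have h1 : volume (oc a l) ≤ volume (oc a l ∩ E) + volume (oc a l ∩ Eᶜ) := by
    refine (measure_mono ?_).trans (measure_union_le _ _)
    rw [inter_union_compl]
  rw [vol_oc a l hl] at h1
  have h2 : ENNReal.ofReal (l ^ n) = ENNReal.ofReal (l ^ n / 2) + ENNReal.ofReal (l ^ n / 2) := by
    rw [← ENNReal.ofReal_add (by positivity) (by positivity)]; congr 1; ring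
  rw [h2] at h1
  exact (ENNReal.add_le_add_iff_left ENNReal.ofReal_ne_top).1 (h1.trans (add_le_add_left h _))

/-- small density: relative isoperimetric inequality -/
lemma small_case {n : ℕ} (E M : Set (Fin (n+1) → ℝ)) (hE : MeasurableSet E)
    (hM : ∀ x, x ∉ M → x ∈ lowDens E ∨ x ∈ lowDens Eᶜ)
    (a : Fin (n+1) → ℝ) (l : ℝ) (hl : 0 < l) (lam : ℝ) (h0 : 0 < lam) (h1 : lam ≤ 1/2)
    (hvol : volume (oc a l ∩ E) = ENNReal.ofReal (lam * l ^ (n+1)))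
    (ν : Measure (Fin (n+1) → ℝ))
    (hν : ∀ b δ j, volume (pr j '' (M ∩ oc b δ)) ≤ ν (oc b δ)) (h : ℝ) (hh0 : 0 ≤ h)
    (hh : ν (oc a l) ≤ ENNReal.ofReal h) :
    l ^ n ≤ 8 * (n+1) * lam ^ (-(n:ℝ) / ((n:ℝ)+1)) * h := by
  obtain ⟨N, hN, hN1, hN2⟩ := exists_N n lam h0 h1
  have hNr : (0:ℝ) < N := by exact_mod_cast hN
  set δ := l / N with hδ
  have hδpos : 0 < δ := by positivity
  have hNδ : (N:ℝ) * δ = l := by rw [hδ]; field_simp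
  have hcov := sub_cover a δ hδpos N E
  rw [hNδ, hvol] at hcov
  have heach : ∀ k : Fin (n+1) → Fin N, volume (oc (subA a δ k) δ ∩ E) ≤
      2 * (n+1 : ℕ) * (ENNReal.ofReal δ * ν (oc (subA a δ k) δ)) := by
    intro k
    have hle : volume (oc (subA a δ k) δ ∩ E) ≤ ENNReal.ofReal (δ ^ (n+1) / 2) := by
      calc volume (oc (subA a δ k) δ ∩ E) ≤ volume (oc a l ∩ E) := by
            apply measure_mono
            apply inter_subset_inter_left
            rw [← hNδ]; exact subcube_sub a δ hδpos N k
        _ = _ := hvol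
        _ ≤ _ := by
            apply ENNReal.ofReal_le_ofReal
            rw [← hNδ, mul_pow]
            have : 0 < δ ^ (n+1) := by positivity
            nlinarith
    exact half_aux _ _ _ (n+1) _ (by positivity) (vol_split _ _ hδpos _ hle)
      (pair E M hE hM (subA a δ k) δ hδpos _ (hν _ _))
  have hmeas : ∀ k : Fin (n+1) → Fin N, MeasurableSet (oc (subA a δ k) δ) := by
    intro k; rw [oc_eq]; exact MeasurableSet.univ_pi fun i => measurableSet_Ioo
  have hsum : ∑ k : Fin (n+1) → Fin N, ν (oc (subA a δ k) δ) ≤ ENNReal.ofReal h := by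
    rw [← tsum_fintype (L := .unconditional _), ← measure_iUnion (sub_disj a δ hδpos N) hmeas]
    refine (measure_mono ?_).trans hh
    rw [← hNδ]
    exact iUnion_subset fun k => subcube_sub a δ hδpos N k
  have htot : ENNReal.ofReal (lam * l ^ (n+1)) ≤ ENNReal.ofReal (2 * (n+1) * (δ * h)) := by
    calc _ ≤ _ := hcov
      _ ≤ ∑ k : Fin (n+1) → Fin N, 2 * (n+1 : ℕ) * (ENNReal.ofReal δ * ν (oc (subA a δ k) δ)) :=
          Finset.sum_le_sum fun k _ => heach k
      _ = 2 * (n+1 : ℕ) * (ENNReal.ofReal δ * ∑ k : Fin (n+1) → Fin N, ν (oc (subA a δ k) δ)) := by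
          rw [Finset.mul_sum, Finset.mul_sum]
      _ ≤ 2 * (n+1 : ℕ) * (ENNReal.ofReal δ * ENNReal.ofReal h) := by gcongr
      _ = _ := by
          rw [ENNReal.ofReal_mul (by positivity), ENNReal.ofReal_mul hδpos.le,
            ENNReal.ofReal_mul (by norm_num)]
          congr 2
          · simp
          · rw [← ENNReal.ofReal_natCast]; push_cast; rfl
  rw [ENNReal.ofReal_le_ofReal_iff (by positivity)] at htot
  have h2 : l ^ n ≤ 2 * (n+1) * h * (1 / ((N:ℝ) * lam)) := by
    have h3 : lam * l ^ (n+1) = (l * lam) * l ^ n := by ring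
    have h4 : 2 * ((n:ℝ)+1) * (δ * h) = (l * lam) * (2 * (n+1) * h * (1 / ((N:ℝ) * lam))) := by
      rw [hδ]; field_simp
    rw [h3, h4] at htot
    exact le_of_mul_le_mul_left htot (by positivity)
  calc l ^ n ≤ _ := h2
    _ ≤ 2 * (n+1) * h * (4 * lam ^ (-(n:ℝ) / ((n:ℝ)+1))) := by gcongr
    _ = _ := by ring

lemma core {n : ℕ} (E M : Set (Fin (n+1) → ℝ)) (hE : MeasurableSet E)
    (hM : ∀ x, x ∉ M → x ∈ lowDens E ∨ x ∈ lowDens Eᶜ)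
    (a : Fin (n+1) → ℝ) (l : ℝ) (hl : 0 < l) (lam : ℝ) (h0 : 0 < lam) (h1 : lam < 1)
    (hvol : volume (oc a l ∩ E) = ENNReal.ofReal (lam * l ^ (n+1)))
    (ν : Measure (Fin (n+1) → ℝ))
    (hν : ∀ b δ j, volume (pr j '' (M ∩ oc b δ)) ≤ ν (oc b δ)) (h : ℝ) (hh0 : 0 ≤ h)
    (hh : ν (oc a l) ≤ ENNReal.ofReal h) (j : Fin (n+1)) (Y : Set (Fin (n+1) → ℝ))
    (hY : ∀ y ∈ Y, y ∈ lowDens E ∧ ∀ i, a i ≤ y i ∧ y i ≤ a i + l) :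
    volume (pr j '' Y) ≤ ENNReal.ofReal (8 * (n+1) * lam ^ (-(n:ℝ) / ((n:ℝ)+1)) * h) := by
  rcases le_total lam (1/2) with hlam | hlam
  · have hs := small_case E M hE hM a l hl lam h0 hlam hvol ν hν h hh0 hh
    refine le_trans ?_ (ENNReal.ofReal_le_ofReal hs)
    rw [← vol_oc (pr j a) l hl]
    have h2 : volume (pr j '' Y) ≤ volume {x : Fin n → ℝ | ∀ i, pr j a i ≤ x i ∧ x i ≤ pr j a i + l} := by
      apply measure_mono
      rintro _ ⟨y, hy, rfl⟩ i
      exact (hY y hy).2 _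
    refine h2.trans ?_
    have h3 := oc_ae (pr j a) l
    exact measure_mono_ae (ae_le_set.2 h3)
  · have hp := pair E M hE hM a l hl (ENNReal.ofReal h) (fun j => (hν a l j).trans hh)
    rw [mul_comm] at hp
    have hx := half_aux _ _ _ _ (l ^ (n+1)) (by positivity) (by
      rw [hvol]; apply ENNReal.ofReal_le_ofReal
      have : 0 < l ^ (n+1) := by positivity
      nlinarith) hp
    have ht := trace E M hE hM a l (ENNReal.ofReal h) j ((hν a l j).trans hh) Y hY
    have h4 : ENNReal.ofReal l * volume (pr j '' Y) ≤
        ENNReal.ofReal l * (ENNReal.ofReal h + 2 * (n+1 : ℕ) * ENNReal.ofReal h) := by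
      refine (ht.trans (add_le_add_right hx _)).trans (le_of_eq ?_)
      ring
    rw [ENNReal.mul_le_mul_iff_right (by simpa using hl) ENNReal.ofReal_ne_top] at h4
    refine h4.trans ?_
    have h5 : (2 * (n+1 : ℕ) : ℝ≥0∞) = ENNReal.ofReal (2 * (n+1)) := by
      rw [ENNReal.ofReal_mul (by norm_num)]
      congr 1
      · simp
      · rw [← Nat.cast_add_one (R := ℝ), ENNReal.ofReal_natCast]
    rw [h5, ← ENNReal.ofReal_mul (by positivity), ← ENNReal.ofReal_add hh0 (by positivity)]
    apply ENNReal.ofReal_le_ofReal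
    have h6 : 1 ≤ lam ^ (-(n:ℝ) / ((n:ℝ)+1)) := by
      apply Real.one_le_rpow_of_pos_of_le_one_of_nonpos h0 h1.le
      rw [neg_div]
      have : 0 ≤ (n:ℝ) / (n+1) := by positivity
      linarith
    have h7 : 8 * ((n:ℝ)+1) * 1 * h ≤ 8 * (n+1) * lam ^ (-(n:ℝ) / ((n:ℝ)+1)) * h := by gcongr
    have : 0 ≤ n * h := by positivity
    nlinarith

abbrev EV (n : ℕ) := EuclideanSpace ℝ (Fin (n+1))

/-- the set read in the product space -/
def fl {n : ℕ} (E : Set (EV n)) : Set (Fin (n+1) → ℝ) := (WithLp.toLp 2) ⁻¹' E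

lemma vol_fl {n : ℕ} (E : Set (EV n)) : volume (fl E) = volume E := by
  exact (PiLp.volume_preserving_toLp (Fin (n+1))).measure_preimage_equiv (f := MeasurableEquiv.toLp 2 _) E

noncomputable def KK (n : ℕ) : NNReal := (Fintype.card (Fin (n+1)) : NNReal) ^ (1 / (2:ℝ≥0∞)).toReal

lemma KK_pos (n : ℕ) : 0 < KK n := by
  unfold KK
  apply NNReal.rpow_pos
  simp

lemma lip_toLp (n : ℕ) : LipschitzWith (KK n) (@WithLp.toLp 2 (Fin (n+1) → ℝ)) :=
  PiLp.lipschitzWith_toLp 2 _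

lemma lowDens_of_not {n : ℕ} (E : Set (EV n)) (x : Fin (n+1) → ℝ)
    (hx : WithLp.toLp 2 x ∉ mClos E) : x ∈ lowDens (fl E) := by
  intro ε hε
  have hK : (0:ℝ) < KK n := KK_pos n
  have hx1 : Filter.limsup (fun r : ℝ => volume (Metric.ball (WithLp.toLp 2 x : EV n) r ∩ E) /
      ENNReal.ofReal (r ^ (n+1))) (nhdsWithin 0 (Set.Ioi 0)) <
      ENNReal.ofReal (ε / (KK n : ℝ) ^ (n+1)) := by
    have this := hx
    rw [mClos, mem_ofPred_eq, not_lt] at this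
    refine this.trans_lt ?_
    rw [ENNReal.ofReal_pos]; positivity
  have h1 := eventually_lt_of_limsup_lt hx1
  rw [eventually_nhdsWithin_iff, Metric.eventually_nhds_iff] at h1
  obtain ⟨r1, hr1, h1⟩ := h1
  refine ⟨r1 / KK n, by positivity, fun r hr hr2 => ?_⟩
  have h2 : (KK n : ℝ) * r < r1 := by rwa [lt_div_iff₀ hK, mul_comm] at hr2
  have h3 := h1 (y := KK n * r) (by rw [Real.dist_eq, sub_zero, abs_of_pos (by positivity)]; exact h2)
    (by simp; positivity)
  have hpos : 0 < ((KK n : ℝ) * r) ^ (n+1) := by positivity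
  have h4 : volume (Metric.ball (WithLp.toLp 2 x : EV n) (KK n * r) ∩ E) ≤
      ENNReal.ofReal (ε * r ^ (n+1)) := by
    have h5 := (ENNReal.div_le_iff (by simpa using hpos) ENNReal.ofReal_ne_top).1 h3.le
    rw [← ENNReal.ofReal_mul (by positivity)] at h5
    refine h5.trans (le_of_eq ?_)
    congr 1
    rw [mul_pow]; field_simp
  refine le_trans ?_ h4
  rw [← vol_fl]
  apply measure_mono
  rintro y ⟨hy, hyE⟩
  refine ⟨?_, hyE⟩
  have := (lip_toLp n).dist_le_mul y x
  rw [mem_ball] at hy ⊢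
  exact this.trans_lt (by gcongr)

lemma lip_pr {n : ℕ} (j : Fin (n+1)) :
    LipschitzWith 1 (fun v : EV n => pr j (WithLp.ofLp v)) := by
  have h : LipschitzWith 1 (pr j) := by
    apply LipschitzWith.of_dist_le_mul
    intro x y
    rw [NNReal.coe_one, one_mul, dist_pi_le_iff dist_nonneg]
    intro k
    exact dist_le_pi_dist x y _
  have h2 := h.comp (PiLp.lipschitzWith_ofLp 2 (fun _ : Fin (n+1) => ℝ))
  rw [one_mul] at h2
  exact h2

lemma lip_ins {n : ℕ} (j : Fin (n+1)) (c : ℝ) :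
    LipschitzWith (KK n) (fun z : Fin n → ℝ => (WithLp.toLp 2 (ins j c z) : EV n)) := by
  have h : LipschitzWith 1 (ins j c) := by
    apply LipschitzWith.of_dist_le_mul
    intro x y
    rw [NNReal.coe_one, one_mul, dist_pi_le_iff dist_nonneg]
    intro i
    rcases Fin.eq_self_or_eq_succAbove j i with rfl | ⟨k, rfl⟩
    · simp
    · simpa using dist_le_pi_dist x y k
  have h2 := (lip_toLp n).comp h
  rw [mul_one] at h2
  exact h2

lemma muH_eq (n : ℕ) : (μH[(n:ℝ)] : Measure (Fin n → ℝ)) = volume := by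
  have := hausdorffMeasure_pi_real (ι := Fin n)
  simpa using this

lemma face {n : ℕ} (j : Fin (n+1)) (c : ℝ) (S : Set (EV n)) (hS : ∀ v ∈ S, v j = c) :
    μH[(n:ℝ)] S ≤ (KK n : ℝ≥0∞) ^ (n:ℝ) * volume (pr j '' (fl S)) := by
  rw [← muH_eq]
  refine le_trans (measure_mono ?_) ((lip_ins j c).hausdorffMeasure_image_le (Nat.cast_nonneg n) _)
  intro v hv
  refine ⟨pr j (WithLp.ofLp v), ⟨WithLp.ofLp v, hv, rfl⟩, ?_⟩
  have := ins_pr j (WithLp.ofLp v)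
  simp only
  rw [← hS v hv, this]

lemma proj_le {n : ℕ} (j : Fin (n+1)) (S : Set (EV n)) :
    volume (pr j '' (fl S)) ≤ μH[(n:ℝ)] S := by
  rw [← muH_eq]
  have := (lip_pr j).hausdorffMeasure_image_le (Nat.cast_nonneg n : (0:ℝ) ≤ n) S
  simp only [ENNReal.coe_one, ENNReal.one_rpow, one_mul] at this
  refine le_trans (measure_mono ?_) this
  rintro _ ⟨x, hx, rfl⟩
  exact ⟨_, hx, rfl⟩

lemma oc_open {n : ℕ} (a : Fin n → ℝ) (l : ℝ) : IsOpen (oc a l) := by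
  rw [oc_eq]; exact isOpen_set_pi finite_univ fun _ _ => isOpen_Ioo

lemma oce_sub {n : ℕ} (a : EV n) (l : ℝ) :
    (WithLp.ofLp) ⁻¹' (oc (WithLp.ofLp a) l) ⊆ interior (cube a l) := by
  apply interior_maximal
  · intro v hv i
    exact ⟨(hv i).1.le, (hv i).2.le⟩
  · exact (oc_open _ _).preimage (PiLp.continuous_ofLp 2 _)

lemma cube_closed {n : ℕ} (a : EV n) (l : ℝ) : IsClosed (cube a l) := by
  have : cube a l = ⋂ i, {x : EV n | a i ≤ x i ∧ x i ≤ a i + l} := by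
    ext x; simp [cube]
  rw [this]
  refine isClosed_iInter fun i => ?_
  have hc : Continuous fun x : EV n => x i := by fun_prop
  exact (isClosed_le continuous_const hc).inter (isClosed_le hc continuous_const)

lemma frontier_sub {n : ℕ} (a : EV n) (l : ℝ) (v : EV n) (hv : v ∈ frontier (cube a l)) :
    v ∈ cube a l ∧ ∃ j, v j = a j ∨ v j = a j + l := by
  rw [(cube_closed a l).frontier_eq] at hv
  refine ⟨hv.1, ?_⟩
  by_contra! hc
  refine hv.2 (oce_sub a l ?_)
  intro i
  have h1 := hv.1 i
  have h2 := hc i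
  exact ⟨lt_of_le_of_ne h1.1 h2.1.symm, lt_of_le_of_ne h1.2 h2.2⟩

lemma main_aux (n : ℕ) (E : Set (EV n)) (a : EV n) (l lam : ℝ) (hE : MeasurableSet E) (hl : 0 < l)
    (h0 : 0 < lam) (h1 : lam < 1)
    (hv : volume (E ∩ cube a l) = ENNReal.ofReal lam * volume (cube a l)) :
    μH[(n:ℝ)] (frontier (cube a l) \ mClos E) ≤
      ENNReal.ofReal ((16 * (n+1) * (n+1) * (KK n : ℝ) ^ n) * lam ^ (-(n:ℝ) / ((n:ℝ)+1))) *
        μH[(n:ℝ)] (mBdry E ∩ interior (cube a l)) := by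
  have hK : (0:ℝ) < KK n := KK_pos n
  have hlp : 0 < lam ^ (-(n:ℝ) / ((n:ℝ)+1)) := Real.rpow_pos_of_pos h0 _
  set H := μH[(n:ℝ)] (mBdry E ∩ interior (cube a l)) with hH
  by_cases hT : H = ⊤
  · rw [hT, ENNReal.mul_top]
    · exact le_top
    · rw [Ne, ENNReal.ofReal_eq_zero, not_le]; positivity
  have hHr : H = ENNReal.ofReal H.toReal := (ENNReal.ofReal_toReal hT).symm
  have hEm : MeasurableSet (fl E) := (PiLp.volume_preserving_toLp (Fin (n+1))).measurable hE
  have hM : ∀ x, x ∉ fl (mBdry E) → x ∈ lowDens (fl E) ∨ x ∈ lowDens (fl E)ᶜ := by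
    intro x hx
    have hx2 : ¬ (WithLp.toLp 2 x ∈ mClos E ∧ WithLp.toLp 2 x ∈ mClos Eᶜ) := hx
    rw [not_and_or] at hx2
    exact hx2.imp (lowDens_of_not E x) (lowDens_of_not Eᶜ x)
  have hcv : volume (cube a l) = ENNReal.ofReal (l ^ (n+1)) := by
    rw [← vol_fl, ← vol_oc (WithLp.ofLp a) l hl]
    apply le_antisymm
    · exact measure_mono_ae (ae_le_set.2 (oc_ae (WithLp.ofLp a) l))
    · exact measure_mono fun x hx i => ⟨(hx i).1.le, (hx i).2.le⟩
  have hvol : volume (oc (WithLp.ofLp a) l ∩ fl E) = ENNReal.ofReal (lam * l ^ (n+1)) := by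
    rw [ENNReal.ofReal_mul h0.le, ← hcv, ← hv, ← vol_fl (E ∩ cube a l)]
    apply le_antisymm
    · exact measure_mono fun x hx => ⟨hx.2, fun i => ⟨(hx.1 i).1.le, (hx.1 i).2.le⟩⟩
    · have h2 : ∀ᵐ x, x ∈ {x : Fin (n+1) → ℝ | ∀ i, a i ≤ x i ∧ x i ≤ a i + l} →
          x ∈ oc (WithLp.ofLp a) l := ae_le_set.2 (oc_ae (WithLp.ofLp a) l)
      apply measure_mono_ae
      filter_upwards [h2] with x hx hx2
      exact ⟨hx hx2.2, hx2.1⟩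
  have hof : Measurable (WithLp.ofLp : EV n → Fin (n+1) → ℝ) :=
    (PiLp.continuous_ofLp 2 _).measurable
  set ν : Measure (Fin (n+1) → ℝ) :=
    Measure.map (WithLp.ofLp) ((μH[(n:ℝ)] : Measure (EV n)).restrict (mBdry E)) with hνdef
  have hνoc : ∀ b δ, ν (oc b δ) = μH[(n:ℝ)] ((WithLp.ofLp) ⁻¹' (oc b δ) ∩ mBdry E) := by
    intro b δ
    rw [hνdef, Measure.map_apply hof (oc_open b δ).measurableSet,
      Measure.restrict_apply (hof (oc_open b δ).measurableSet)]
  have hν : ∀ b δ j, volume (pr j '' (fl (mBdry E) ∩ oc b δ)) ≤ ν (oc b δ) := by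
    intro b δ j
    rw [hνoc]
    refine le_trans (measure_mono (image_mono ?_)) (proj_le j _)
    intro x hx
    exact ⟨hx.2, hx.1⟩
  have hh : ν (oc (WithLp.ofLp a) l) ≤ ENNReal.ofReal H.toReal := by
    rw [← hHr, hνoc, hH]
    exact measure_mono fun x hx => ⟨hx.2, oce_sub a l hx.1⟩
  have hpiece : ∀ (j : Fin (n+1)) (c : ℝ),
      μH[(n:ℝ)] {v : EV n | v ∈ cube a l ∧ v ∉ mClos E ∧ v j = c} ≤
        ENNReal.ofReal ((KK n : ℝ) ^ n * (8 * (n+1) * lam ^ (-(n:ℝ) / ((n:ℝ)+1)) * H.toReal)) := by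
    intro j c
    refine (face j c _ fun v hv => hv.2.2).trans ?_
    rw [ENNReal.ofReal_mul (by positivity)]
    refine mul_le_mul' (le_of_eq ?_) ?_
    · rw [ENNReal.rpow_natCast, ENNReal.ofReal_pow hK.le, ENNReal.ofReal_coe_nnreal]
    · refine core (fl E) (fl (mBdry E)) hEm hM (WithLp.ofLp a) l hl lam h0 h1 hvol ν hν _
        ENNReal.toReal_nonneg hh j _ ?_
      intro y hy
      exact ⟨lowDens_of_not E y hy.2.1, hy.1⟩
  set B := (KK n : ℝ) ^ n * (8 * (n+1) * lam ^ (-(n:ℝ) / ((n:ℝ)+1)) * H.toReal) with hB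
  have hB0 : 0 ≤ B := by have := ENNReal.toReal_nonneg (a := H); positivity
  have hcov : frontier (cube a l) \ mClos E ⊆ ⋃ j : Fin (n+1),
      ({v : EV n | v ∈ cube a l ∧ v ∉ mClos E ∧ v j = a j} ∪
        {v : EV n | v ∈ cube a l ∧ v ∉ mClos E ∧ v j = a j + l}) := by
    rintro v ⟨hv1, hv2⟩
    obtain ⟨h3, j, h4⟩ := frontier_sub a l v hv1
    refine mem_iUnion.2 ⟨j, ?_⟩
    exact h4.imp (fun h => ⟨h3, hv2, h⟩) (fun h => ⟨h3, hv2, h⟩)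
  calc μH[(n:ℝ)] (frontier (cube a l) \ mClos E)
      ≤ ∑ j : Fin (n+1), μH[(n:ℝ)] ({v : EV n | v ∈ cube a l ∧ v ∉ mClos E ∧ v j = a j} ∪
        {v : EV n | v ∈ cube a l ∧ v ∉ mClos E ∧ v j = a j + l}) :=
        (measure_mono hcov).trans (measure_iUnion_fintype_le _ _)
    _ ≤ ∑ j : Fin (n+1), ENNReal.ofReal (B + B) := by
        refine Finset.sum_le_sum fun j _ => ?_
        rw [ENNReal.ofReal_add hB0 hB0]
        exact (measure_union_le _ _).trans (add_le_add (hpiece j _) (hpiece j _))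
    _ = ENNReal.ofReal ((n+1) * (B + B)) := by
        rw [Finset.sum_const, Finset.card_univ, Fintype.card_fin, nsmul_eq_mul,
          ENNReal.ofReal_mul (by positivity), ← Nat.cast_add_one, ENNReal.ofReal_natCast]
    _ = _ := by
        rw [hHr, ← ENNReal.ofReal_mul (by positivity)]
        congr 1
        rw [hB]; ring

/-- if `|E ∩ Q| = λ|Q|` then
`H^{d-1}(∂Q ∖ cl*E) ≤ C_d λ^{-(d-1)/d} H^{d-1}(∂*E ∩ int Q)`. -/
theorem stmt7 (d : ℕ) (hd : 1 ≤ d) :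
    ∃ C : ℝ, 0 < C ∧
      ∀ (E : Set (EuclideanSpace ℝ (Fin d))) (a : EuclideanSpace ℝ (Fin d)) (l lam : ℝ),
        MeasurableSet E → 0 < l → 0 < lam → lam < 1 →
        volume (E ∩ cube a l) = ENNReal.ofReal lam * volume (cube a l) →
        μH[(d : ℝ) - 1] (frontier (cube a l) \ mClos E)
          ≤ ENNReal.ofReal (C * lam ^ (-((d : ℝ) - 1) / d)) *
            μH[(d : ℝ) - 1] (mBdry E ∩ interior (cube a l)) := by
  obtain ⟨n, rfl⟩ : ∃ n, d = n + 1 := ⟨d - 1, by omega⟩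
  have hK : (0:ℝ) < KK n := KK_pos n
  refine ⟨16 * (n+1) * (n+1) * (KK n : ℝ) ^ n, by positivity, ?_⟩
  intro E a l lam hE hl h0 h1 hv
  have h := main_aux n E a l lam hE hl h0 h1 hv
  have e1 : ((n + 1 : ℕ) : ℝ) - 1 = n := by push_cast; ring
  have e2 : ((n + 1 : ℕ) : ℝ) = n + 1 := by push_cast; ring
  rw [e1, e2]
  exact h
end

section
/- Let λ ∈ (0,1), let E ⊆ ℝ^d have locally finite perimeter, and let ℬ be a finite set of open balls with |E∩B| > λ|B| for every B ∈ ℬ. Then H^{d-1}(∂*(⋃ℬ) ∖ cl*E) ≤ C_d · λ^{-(d-1)/d} · (1 − log λ) · H^{d-1}(∂*E ∩ ⋃ℬ), with C_d depending only on d. -/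
open MeasureTheory Metric Set Filter
open scoped ENNReal

/-- Divergence of a vector field. -/
noncomputable def divg {d : ℕ} (φ : EuclideanSpace ℝ (Fin d) → EuclideanSpace ℝ (Fin d))
    (x : EuclideanSpace ℝ (Fin d)) : ℝ :=
  ∑ i, fderiv ℝ φ x (EuclideanSpace.single i 1) i

/-- The variation of `f` in the open set `Ω`. -/
noncomputable def var {d : ℕ} (Ω : Set (EuclideanSpace ℝ (Fin d)))
    (f : EuclideanSpace ℝ (Fin d) → ℝ) : ℝ≥0∞ :=
  ⨆ (φ : EuclideanSpace ℝ (Fin d) → EuclideanSpace ℝ (Fin d)) (_ : ContDiff ℝ 1 φ)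
    (_ : HasCompactSupport φ) (_ : tsupport φ ⊆ Ω) (_ : ∀ x, ‖φ x‖ ≤ 1),
    ENNReal.ofReal (∫ x in Ω, f x * divg φ x)

/-- A set has locally finite perimeter if its indicator has locally bounded variation. -/
def HasLocFinitePerimeter {d : ℕ} (E : Set (EuclideanSpace ℝ (Fin d))) : Prop :=
  ∀ U : Set (EuclideanSpace ℝ (Fin d)), IsOpen U → Bornology.IsBounded U →
    var U (E.indicator fun _ => (1 : ℝ)) < ⊤

abbrev V (n : ℕ) := EuclideanSpace ℝ (Fin (n + 1))

noncomputable def om (n : ℕ) : ℝ := volume.real (ball (0 : V n) 1)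

lemma om_pos (n : ℕ) : 0 < om n := by
  unfold om
  exact ENNReal.toReal_pos (measure_ball_pos _ _ one_pos).ne' measure_ball_lt_top.ne

lemma vol_ball {n : ℕ} (x : V n) {r : ℝ} (hr : 0 ≤ r) :
    volume (ball x r) = ENNReal.ofReal (r ^ (n + 1) * om n) := by
  rw [Measure.addHaar_ball _ _ hr, finrank_euclideanSpace, Fintype.card_fin,
    ENNReal.ofReal_mul (by positivity)]
  congr 1
  unfold om
  rw [ofReal_measureReal measure_ball_lt_top.ne]

lemma vol_closedBall {n : ℕ} (x : V n) {r : ℝ} (hr : 0 ≤ r) :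
    volume (closedBall x r) = ENNReal.ofReal (r ^ (n + 1) * om n) := by
  rw [Measure.addHaar_closedBall_eq_addHaar_ball, vol_ball x hr]

lemma volr_ball {n : ℕ} (x : V n) {r : ℝ} (hr : 0 ≤ r) :
    volume.real (ball x r) = r ^ (n + 1) * om n := by
  have := om_pos n
  rw [measureReal_def, vol_ball x hr, ENNReal.toReal_ofReal (by positivity)]

lemma volr_closedBall {n : ℕ} (x : V n) {r : ℝ} (hr : 0 ≤ r) :
    volume.real (closedBall x r) = r ^ (n + 1) * om n := by
  have := om_pos n
  rw [measureReal_def, vol_closedBall x hr, ENNReal.toReal_ofReal (by positivity)]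

lemma ball_inter_ne_top {n : ℕ} (x : V n) (r : ℝ) (E : Set (V n)) :
    volume (ball x r ∩ E) ≠ ⊤ :=
  ((measure_mono inter_subset_left).trans_lt measure_ball_lt_top).ne

lemma ratio_le_iff {n : ℕ} (x : V n) (E : Set (V n)) {r ε : ℝ} (hr : 0 < r) (hε : 0 ≤ ε) :
    volume (ball x r ∩ E) / ENNReal.ofReal (r ^ (n + 1)) ≤ ENNReal.ofReal ε ↔
      volume.real (ball x r ∩ E) ≤ ε * r ^ (n + 1) := by
  have h1 : 0 < r ^ (n + 1) := by positivity
  rw [ENNReal.div_le_iff (by simpa using h1) ENNReal.ofReal_ne_top,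
    ← ENNReal.ofReal_mul hε, ← ofReal_measureReal (ball_inter_ne_top x r E),
    ENNReal.ofReal_le_ofReal_iff (by positivity)]

lemma not_mem_mClos_iff {n : ℕ} {x : V n} {E : Set (V n)} :
    x ∉ mClos E ↔ ∀ ε > 0, ∃ δ > 0, ∀ r, 0 < r → r < δ →
      volume.real (ball x r ∩ E) ≤ ε * r ^ (n + 1) := by
  have key : x ∉ mClos E ↔ Tendsto (fun r : ℝ => volume (Metric.ball x r ∩ E) /
      ENNReal.ofReal (r ^ (n + 1))) (nhdsWithin 0 (Set.Ioi 0)) (nhds 0) := by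
    unfold mClos
    simp only [mem_ofPred_eq, not_lt, nonpos_iff_eq_zero]
    constructor
    · intro h
      exact tendsto_of_le_liminf_of_limsup_le zero_le h.le
    · intro h
      exact h.limsup_eq
  rw [key, ENNReal.tendsto_nhds_zero]
  constructor
  · intro h ε hε
    have := h (ENNReal.ofReal ε) (by simpa using hε)
    rw [eventually_nhdsWithin_iff, Metric.eventually_nhds_iff] at this
    obtain ⟨δ, hδ, h2⟩ := this
    refine ⟨δ, hδ, fun r hr hrd => ?_⟩
    rw [← ratio_le_iff x E hr hε.le]
    exact h2 (by simpa [abs_of_pos hr] using hrd) hr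
  · intro h ε hε
    by_cases ht : ε = ⊤
    · simp [ht]
    obtain ⟨δ, hδ, h2⟩ := h ε.toReal (ENNReal.toReal_pos hε.ne' ht)
    rw [eventually_nhdsWithin_iff, Metric.eventually_nhds_iff]
    refine ⟨δ, hδ, fun {r} hr hr0 => ?_⟩
    have h3 := h2 r hr0 (by simpa [abs_of_pos (show 0 < r from hr0)] using hr)
    rw [← ratio_le_iff x E hr0 ENNReal.toReal_nonneg, ENNReal.ofReal_toReal ht] at h3
    exact h3

lemma ae_not_mem_mClos_compl {n : ℕ} {E : Set (V n)} (hE : MeasurableSet E) :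
    ∀ᵐ x : V n, x ∈ E → x ∉ mClos Eᶜ := by
  filter_upwards [Besicovitch.ae_tendsto_measure_inter_div_of_measurableSet
    (volume : Measure (V n)) hE.compl] with x hx hxE
  rw [indicator_of_notMem (by simpa using hxE), ENNReal.tendsto_nhds_zero] at hx
  rw [not_mem_mClos_iff]
  intro ε hε
  have hom := om_pos n
  have := hx (ENNReal.ofReal (ε / om n)) (by simpa using div_pos hε hom)
  rw [eventually_nhdsWithin_iff, Metric.eventually_nhds_iff] at this
  obtain ⟨δ, hδ, h2⟩ := this
  refine ⟨δ, hδ, fun r hr hrd => ?_⟩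
  have h3 := h2 (by simpa [abs_of_pos hr] using hrd) hr
  have h1 : 0 < r ^ (n + 1) * om n := by positivity
  rw [vol_closedBall x hr.le, ENNReal.div_le_iff (by simpa using h1) ENNReal.ofReal_ne_top,
    ← ENNReal.ofReal_mul (by positivity)] at h3
  have h4 : volume (ball x r ∩ Eᶜ) ≤ ENNReal.ofReal (ε * r ^ (n + 1)) := by
    refine (measure_mono ?_).trans (h3.trans (le_of_eq ?_))
    · intro y hy
      exact ⟨hy.2, ball_subset_closedBall hy.1⟩
    · congr 1
      field_simp
  rw [measureReal_def]
  exact ENNReal.toReal_le_of_le_ofReal (by positivity) h4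

/-- points with uniformly small density below scale `ρ` -/
def Gd {n : ℕ} (E : Set (V n)) (c ρ : ℝ) : Set (V n) :=
  {x | ∀ r, 0 < r → r < ρ → volume.real (ball x r ∩ E) ≤ c * r ^ (n + 1)}

lemma isClosed_Gd {n : ℕ} (E : Set (V n)) (c ρ : ℝ) : IsClosed (Gd E c ρ) := by
  rw [← isSeqClosed_iff_isClosed]
  intro u x hu hx r hr hrρ
  -- for all r' in (r, ρ)
  have h1 : ∀ r' ∈ Ioo r ρ, volume.real (ball x r ∩ E) ≤ c * r' ^ (n + 1) := by
    intro r' hr'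
    obtain ⟨N, hN⟩ := (Metric.tendsto_atTop.1 hx) (r' - r) (by linarith [hr'.1])
    refine le_trans ?_ (hu N r' (hr.trans hr'.1) hr'.2)
    refine measureReal_mono ?_ (ball_inter_ne_top _ _ _)
    gcongr
    apply ball_subset_ball'
    have := hN N le_rfl
    rw [dist_comm] at this
    linarith
  have h2 : Tendsto (fun r' : ℝ => c * r' ^ (n + 1)) (nhdsWithin r (Ioi r))
      (nhds (c * r ^ (n + 1))) := by
    apply Tendsto.mono_left _ nhdsWithin_le_nhds
    exact (by fun_prop : Continuous fun r' : ℝ => c * r' ^ (n + 1)).tendsto r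
  refine ge_of_tendsto h2 ?_
  filter_upwards [Ioo_mem_nhdsGT hrρ] with r' hr' using h1 r' hr'

lemma exists_Gd {n : ℕ} {E : Set (V n)} {x : V n} (hx : x ∉ mClos E) {c : ℝ} (hc : 0 < c) :
    ∃ k : ℕ, x ∈ Gd E c (1 / (k + 1)) := by
  obtain ⟨δ, hδ, h⟩ := not_mem_mClos_iff.1 hx c hc
  obtain ⟨k, hk⟩ := exists_nat_one_div_lt hδ
  exact ⟨k, fun r hr hrk => h r hr (hrk.trans hk)⟩

/-- one dimensional Baire lemma -/
lemma baire_line {A B : Set ℝ} {A' B' : ℕ → Set ℝ} {a b : ℝ}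
    (hcov : Icc a b ⊆ A ∪ B) (hdisj : Disjoint A B)
    (hA' : ∀ k, IsClosed (A' k)) (hB' : ∀ k, IsClosed (B' k))
    (hA : A ∩ Icc a b ⊆ ⋃ k, A' k) (hB : B ∩ Icc a b ⊆ ⋃ k, B' k)
    (hA2 : ∀ k, A' k ∩ Icc a b ⊆ A) (hB2 : ∀ k, B' k ∩ Icc a b ⊆ B)
    (h1 : ∀ p ∈ A, ∀ q, p < q → ¬ (Ioo p q ⊆ B))
    (h2 : ∀ p ∈ A, ∀ q, q < p → ¬ (Ioo q p ⊆ B))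
    (h3 : ∀ p ∈ B, ∀ q, p < q → ¬ (Ioo p q ⊆ A))
    (h4 : ∀ p ∈ B, ∀ q, q < p → ¬ (Ioo q p ⊆ A))
    (ha : a ∈ A) (hb : b ∈ B) (hab : a ≤ b) : False := by
  have aux : ∀ (A B : Set ℝ), Icc a b ⊆ A ∪ B → Disjoint A B →
      (∀ p ∈ A, ∀ q, p < q → ¬ (Ioo p q ⊆ B)) →
      (∀ p ∈ A, ∀ q, q < p → ¬ (Ioo q p ⊆ B)) →
      ∀ p ∈ closure (A ∩ Icc a b) ∩ closure (B ∩ Icc a b), ∀ ε > 0,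
      (closure (A ∩ Icc a b) ∩ closure (B ∩ Icc a b)) ∩ ball p ε ⊆ A → False := by
    intro A B hcov hdisj h1 h2 p hp ε hε hI
    obtain ⟨q, hqB, hqd⟩ := Metric.mem_closure_iff.1 hp.2 ε hε
    have hpA : p ∈ A := hI ⟨hp, mem_ball_self hε⟩
    have hpab : p ∈ Icc a b := closure_minimal inter_subset_right isClosed_Icc hp.1
    have hqA : q ∉ closure (A ∩ Icc a b) := by
      intro hq
      have : q ∈ A := hI ⟨⟨hq, subset_closure hqB⟩, by rwa [mem_ball, dist_comm]⟩
      exact disjoint_left.1 hdisj this hqB.1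
    have hne : p ≠ q := by
      rintro rfl
      exact disjoint_left.1 hdisj hpA hqB.1
    rcases lt_or_gt_of_ne hne with hlt | hlt
    · set T := closure (A ∩ Icc a b) ∩ Icc p q with hT
      have hTc : IsCompact T := isCompact_Icc.inter_left isClosed_closure
      have hTn : T.Nonempty := ⟨p, hp.1, le_rfl, hlt.le⟩
      have hm := hTc.sSup_mem hTn
      set m := sSup T
      have hmq : m < q := lt_of_le_of_ne hm.2.2 (by
        intro h; exact hqA (h ▸ hm.1))
      have hB : Ioo m q ⊆ B ∩ Icc a b := by
        intro t ht
        have htab : t ∈ Icc a b :=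
          ⟨hpab.1.trans (hm.2.1.trans ht.1.le), ht.2.le.trans hqB.2.2⟩
        rcases hcov htab with h | h
        · exfalso
          have : t ∈ T := ⟨subset_closure ⟨h, htab⟩, hm.2.1.trans ht.1.le, ht.2.le⟩
          exact absurd (le_csSup hTc.bddAbove this) (not_le.2 ht.1)
        · exact ⟨h, htab⟩
      have hmB : m ∈ closure (B ∩ Icc a b) := by
        apply closure_mono hB
        rw [closure_Ioo hmq.ne]
        exact ⟨le_rfl, hmq.le⟩
      have hmA : m ∈ A := by
        refine hI ⟨⟨hm.1, hmB⟩, ?_⟩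
        rw [mem_ball, Real.dist_eq, abs_of_nonneg (by linarith [hm.2.1])]
        rw [Real.dist_eq, abs_of_neg (by linarith)] at hqd
        linarith
      exact h1 m hmA q hmq (hB.trans inter_subset_left)
    · set T := closure (A ∩ Icc a b) ∩ Icc q p with hT
      have hTc : IsCompact T := isCompact_Icc.inter_left isClosed_closure
      have hTn : T.Nonempty := ⟨p, hp.1, hlt.le, le_rfl⟩
      have hm := hTc.sInf_mem hTn
      set m := sInf T
      have hmq : q < m := lt_of_le_of_ne hm.2.1 (by
        intro h; exact hqA (h ▸ hm.1))
      have hB : Ioo q m ⊆ B ∩ Icc a b := by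
        intro t ht
        have htab : t ∈ Icc a b :=
          ⟨hqB.2.1.trans ht.1.le, (ht.2.le.trans hm.2.2).trans hpab.2⟩
        rcases hcov htab with h | h
        · exfalso
          have : t ∈ T := ⟨subset_closure ⟨h, htab⟩, ht.1.le, ht.2.le.trans hm.2.2⟩
          exact absurd (csInf_le hTc.bddBelow this) (not_le.2 ht.2)
        · exact ⟨h, htab⟩
      have hmB : m ∈ closure (B ∩ Icc a b) := by
        apply closure_mono hB
        rw [closure_Ioo hmq.ne]
        exact ⟨hmq.le, le_rfl⟩
      have hmA : m ∈ A := by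
        refine hI ⟨⟨hm.1, hmB⟩, ?_⟩
        rw [mem_ball, Real.dist_eq, abs_of_nonpos (by linarith [hm.2.2])]
        rw [Real.dist_eq, abs_of_pos (by linarith)] at hqd
        linarith
      exact h2 m hmA q hmq (hB.trans inter_subset_left)
  set F := closure (A ∩ Icc a b) ∩ closure (B ∩ Icc a b) with hF
  have hFc : IsClosed F := isClosed_closure.inter isClosed_closure
  have hFab : F ⊆ Icc a b := fun x hx =>
    closure_minimal inter_subset_right isClosed_Icc hx.1
  have hFn : F.Nonempty := by
    have := isPreconnected_closed_iff.1 (isPreconnected_Icc (a := a) (b := b))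
      _ _ (isClosed_closure (s := A ∩ Icc a b)) (isClosed_closure (s := B ∩ Icc a b))
      (by
        intro t ht
        rcases hcov ht with h | h
        · exact Or.inl (subset_closure ⟨h, ht⟩)
        · exact Or.inr (subset_closure ⟨h, ht⟩))
      ⟨a, ⟨le_rfl, hab⟩, subset_closure ⟨ha, le_rfl, hab⟩⟩
      ⟨b, ⟨hab, le_rfl⟩, subset_closure ⟨hb, hab, le_rfl⟩⟩
    obtain ⟨x, _, hx⟩ := this
    exact ⟨x, hx⟩
  have : Nonempty F := hFn.to_subtype
  have : CompleteSpace F := hFc.completeSpace_coe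
  obtain ⟨i, hi⟩ := nonempty_interior_of_iUnion_of_closed (X := F)
    (f := fun i : ℕ ⊕ ℕ => Sum.elim (fun k => (Subtype.val ⁻¹' A' k : Set F))
      (fun k => (Subtype.val ⁻¹' B' k : Set F)) i)
    (by
      rintro (k | k)
      · exact (hA' k).preimage continuous_subtype_val
      · exact (hB' k).preimage continuous_subtype_val)
    (by
      ext ⟨x, hx⟩
      simp only [mem_iUnion, mem_univ, iff_true]
      rcases hcov (hFab hx) with h | h
      · obtain ⟨k, hk⟩ := mem_iUnion.1 (hA ⟨h, hFab hx⟩)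
        exact ⟨Sum.inl k, hk⟩
      · obtain ⟨k, hk⟩ := mem_iUnion.1 (hB ⟨h, hFab hx⟩)
        exact ⟨Sum.inr k, hk⟩)
  obtain ⟨⟨p, hpF⟩, hp⟩ := hi
  obtain ⟨ε, hε, hball⟩ := Metric.isOpen_iff.1 isOpen_interior _ hp
  rcases i with k | k
  · refine aux A B hcov hdisj h1 h2 p hpF ε hε ?_
    rintro x ⟨hxF, hxb⟩
    have hh := interior_subset (hball (show (⟨x, hxF⟩ : F) ∈ ball ⟨p, hpF⟩ ε from hxb))
    exact hA2 k ⟨hh, hFab hxF⟩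
  · refine aux B A (by rwa [union_comm]) hdisj.symm h3 h4 p ⟨hpF.2, hpF.1⟩ ε hε ?_
    rintro x ⟨hxF, hxb⟩
    have hxF' : x ∈ F := ⟨hxF.2, hxF.1⟩
    have hh := interior_subset (hball (show (⟨x, hxF'⟩ : F) ∈ ball ⟨p, hpF⟩ ε from hxb))
    exact hB2 k ⟨hh, hFab hxF'⟩

lemma null_bad_slab {n : ℕ} {E Hs : Set (V n)} (hHE : volume (Hs \ E) = 0) {c ρ δ : ℝ}
    (hc : c * 5 ^ (n + 1) < om n / 2) (hρ : 0 < ρ) (hδ : 0 < δ) {v : V n} (hv : ‖v‖ = 1)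
    (a : ℝ) :
    volume {y : V n | ∃ t : ℝ, y + t • v ∈ Gd E c ρ ∧
      (∀ s, 0 < s → s < δ → y + t • v + s • v ∈ Hs) ∧
      inner ℝ v (y + t • v) ∈ Ico a (a + δ / 2)} = 0 := by
  set P := {y : V n | ∃ t : ℝ, y + t • v ∈ Gd E c ρ ∧
      (∀ s, 0 < s → s < δ → y + t • v + s • v ∈ Hs) ∧
      inner ℝ v (y + t • v) ∈ Ico a (a + δ / 2)} with hP
  have hvv : inner ℝ v v = (1 : ℝ) := by rw [real_inner_self_eq_norm_sq, hv]; norm_num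
  have hom := om_pos n
  have hPinv : ∀ y (τ : ℝ), y ∈ P → y + τ • v ∈ P := by
    rintro y τ ⟨t, h1, h2, h3⟩
    have : y + τ • v + (t - τ) • v = y + t • v := by module
    exact ⟨t - τ, by rwa [this], by rwa [this], by rwa [this]⟩
  by_contra hne
  have hae := Besicovitch.ae_tendsto_measure_inter_div (volume : Measure (V n)) P
  have : (ae ((volume : Measure (V n)).restrict P)).NeBot := by
    rw [ae_neBot, Ne, Measure.restrict_eq_zero]
    exact hne
  obtain ⟨p, hp⟩ := hae.exists
  have h12 : (2⁻¹ : ℝ≥0∞) < 1 := by norm_num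
  have hev := hp.eventually (lt_mem_nhds h12)
  have hev2 : ∀ᶠ r in nhdsWithin (0 : ℝ) (Ioi 0), r ∈ Ioo 0 (min (ρ / 5) (δ / 5)) :=
    Ioo_mem_nhdsGT (by positivity)
  obtain ⟨r, hr1, hr2⟩ := (hev.and hev2).exists
  have hr0 : 0 < r := hr2.1
  have hrρ : 5 * r < ρ := by
    have := hr2.2.trans_le (min_le_left _ _); linarith
  have hrδ : 5 * r < δ := by
    have := hr2.2.trans_le (min_le_right _ _); linarith
  have hpos : 0 < r ^ (n + 1) * om n := by positivity
  have hr3 : ENNReal.ofReal (r ^ (n + 1) * om n / 2) < volume (P ∩ closedBall p r) := by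
    rw [vol_closedBall p hr0.le, ENNReal.lt_div_iff_mul_lt (by simp [hpos]) (by simp)] at hr1
    refine lt_of_eq_of_lt ?_ hr1
    rw [div_eq_inv_mul, ENNReal.ofReal_mul (by norm_num), ENNReal.ofReal_inv_of_pos (by norm_num)]
    simp
  -- the set of heights
  set T : Set ℝ := {h | ∃ (x : V n) (t : ℝ), x ∈ Gd E c ρ ∧
      (∀ s, 0 < s → s < δ → x + s • v ∈ Hs) ∧
      inner ℝ v x ∈ Ico a (a + δ / 2) ∧ (x + t • v : V n) ∈ closedBall p r ∧
      h = inner ℝ v x} with hT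
  have hTne : T.Nonempty := by
    have : (P ∩ closedBall p r).Nonempty := by
      by_contra h
      rw [not_nonempty_iff_eq_empty] at h
      simp [h] at hr3
    obtain ⟨y, ⟨t, h1, h2, h3⟩, hy⟩ := this
    exact ⟨_, y + t • v, -t, h1, h2, h3, by simpa using hy, rfl⟩
  have hTb : BddAbove T := ⟨a + δ / 2, by
    rintro h ⟨x, t, _, _, h3, _, rfl⟩; exact h3.2.le⟩
  obtain ⟨_, ⟨x, t, hxG, hxH, hxa, hxp, rfl⟩, hxs⟩ :=
    exists_lt_of_lt_csSup hTne (show sSup T - r / 10 < sSup T by linarith)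
  set τ : ℝ := inner ℝ v x + 6 / 5 * r - inner ℝ v p with hτ
  set q : V n := p + τ • v with hq
  have hqh : inner ℝ v q = inner ℝ v x + 6 / 5 * r := by
    rw [hq, inner_add_right, inner_smul_right, hvv, hτ]; ring
  have hsub : closedBall q r ⊆ ball x (5 * r) := by
    have hw : ‖x + t • v - p‖ ≤ r := by rwa [mem_closedBall, dist_eq_norm] at hxp
    have e1 : x - q = (x + t • v - p) - (t + τ) • v := by rw [hq]; module
    have e2 : inner ℝ v (x - q) = inner ℝ v (x + t • v - p) - (t + τ) := by
      rw [e1, inner_sub_right (x := v) (y := x + t • v - p), inner_smul_right, hvv]; ring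
    have e3 : inner ℝ v (x - q) = -(6 / 5 * r) := by
      rw [inner_sub_right, hqh]; ring
    have e4 : |inner ℝ v (x + t • v - p)| ≤ r := by
      have := abs_real_inner_le_norm v (x + t • v - p)
      rw [hv, one_mul] at this
      exact this.trans hw
    have e5 : |t + τ| ≤ 11 / 5 * r := by
      rw [abs_le] at e4 ⊢
      constructor <;> linarith [e4.1, e4.2]
    have e6 : ‖x - q‖ ≤ 16 / 5 * r := by
      rw [e1]
      calc _ ≤ ‖x + t • v - p‖ + ‖(t + τ) • v‖ := norm_sub_le _ _
        _ ≤ r + 11 / 5 * r := by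
          rw [norm_smul, hv, mul_one, Real.norm_eq_abs]; gcongr
        _ = _ := by ring
    intro y hy
    rw [mem_ball]
    calc dist y x ≤ dist y q + dist q x := dist_triangle _ _ _
      _ ≤ r + 16 / 5 * r := by
        rw [dist_comm q x, dist_eq_norm x q]; exact add_le_add hy e6
      _ < 5 * r := by linarith
  have hPH : P ∩ closedBall q r ⊆ Hs := by
    rintro y ⟨⟨t', h1, h2, h3⟩, hy⟩
    have hle : inner ℝ v (y + t' • v) ≤ sSup T := by
      apply le_csSup hTb
      refine ⟨y + t' • v, -t' - τ, h1, h2, h3, ?_, rfl⟩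
      rw [mem_closedBall, dist_eq_norm] at hy ⊢
      convert hy using 2
      rw [hq]; module
    have hyq : |inner ℝ v (y - q)| ≤ r := by
      have := abs_real_inner_le_norm v (y - q)
      rw [hv, one_mul] at this
      rw [mem_closedBall, dist_eq_norm] at hy
      exact this.trans hy
    rw [inner_sub_right, hqh, abs_le] at hyq
    have h5 : inner ℝ v (y + t' • v) = inner ℝ v y + t' := by
      rw [inner_add_right, inner_smul_right, hvv]; ring
    rw [h5] at hle h3
    have h6 := h2 (-t') (by linarith [hyq.1]) (by linarith [hyq.2, hxa.2, h3.1])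
    simpa using h6
  have hvol : volume (P ∩ closedBall q r) = volume (P ∩ closedBall p r) := by
    rw [← measure_preimage_add_right volume (τ • v) (P ∩ closedBall q r)]
    congr 1
    ext y
    simp only [mem_preimage, mem_inter_iff, mem_closedBall, hq, dist_add_right]
    refine and_congr_left fun _ => ⟨fun h => ?_, fun h => hPinv _ _ h⟩
    simpa using hPinv _ (-τ) h
  have h7 : volume (P ∩ closedBall q r) ≤ volume (ball x (5 * r) ∩ E) := by
    calc volume (P ∩ closedBall q r) ≤ volume ((ball x (5 * r) ∩ E) ∪ (Hs \ E)) := by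
          apply measure_mono
          intro y hy
          by_cases hyE : y ∈ E
          · exact Or.inl ⟨hsub hy.2, hyE⟩
          · exact Or.inr ⟨hPH hy, hyE⟩
      _ ≤ _ := (measure_union_le _ _).trans (by rw [hHE, add_zero])
  have h8 := hxG (5 * r) (by linarith) hrρ
  have h9 : r ^ (n + 1) * om n / 2 < volume.real (ball x (5 * r) ∩ E) := by
    rw [measureReal_def]
    exact (ENNReal.ofReal_lt_iff_lt_toReal (by positivity) (ball_inter_ne_top _ _ _)).1
      (hr3.trans_le (hvol ▸ h7))
  rw [mul_pow, ← mul_assoc] at h8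
  have : 0 < r ^ (n + 1) := by positivity
  nlinarith

lemma null_bad {n : ℕ} {E Hs : Set (V n)} (hHE : volume (Hs \ E) = 0) {c ρ δ : ℝ}
    (hc : c * 5 ^ (n + 1) < om n / 2) (hρ : 0 < ρ) (hδ : 0 < δ) {v : V n} (hv : ‖v‖ = 1) :
    volume {y : V n | ∃ t : ℝ, y + t • v ∈ Gd E c ρ ∧
      (∀ s, 0 < s → s < δ → y + t • v + s • v ∈ Hs)} = 0 := by
  refine measure_mono_null ?_ (measure_iUnion_null
    (fun j : ℤ => null_bad_slab hHE hc hρ hδ hv (j * (δ / 2))))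
  rintro y ⟨t, h1, h2⟩
  refine mem_iUnion.2 ⟨⌊inner ℝ v (y + t • v) / (δ / 2)⌋, t, h1, h2, ?_, ?_⟩
  · have := Int.floor_le (inner ℝ v (y + t • v) / (δ / 2))
    rwa [le_div_iff₀ (by positivity)] at this
  · have := Int.lt_floor_add_one (inner ℝ v (y + t • v) / (δ / 2))
    rw [div_lt_iff₀ (by positivity)] at this
    linarith

noncomputable def cc (n : ℕ) : ℝ := om n / (4 * 5 ^ (n + 1))

lemma cc_pos (n : ℕ) : 0 < cc n := by
  have := om_pos n
  unfold cc; positivity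

lemma cc_lt (n : ℕ) : cc n * 5 ^ (n + 1) < om n / 2 := by
  have := om_pos n
  unfold cc
  rw [div_mul_eq_mul_div, mul_comm 4, ← div_div, mul_div_assoc, div_self (by positivity)]
  linarith

lemma vol_split_s12 {n : ℕ} {E : Set (V n)} (hE : MeasurableSet E) (x : V n) {r : ℝ} (hr : 0 ≤ r) :
    volume.real (ball x r ∩ E) + volume.real (ball x r ∩ Eᶜ) = r ^ (n + 1) * om n := by
  rw [← volr_ball x hr, ← sdiff_eq]
  exact measureReal_inter_add_sdiff hE measure_ball_lt_top.ne

/-- a point with small density of `E` cannot have density zero of the complement -/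
lemma Gd_mem {n : ℕ} {E : Set (V n)} (hE : MeasurableSet E) {x : V n} {ρ : ℝ} (hρ : 0 < ρ)
    (h : x ∈ Gd E (cc n) ρ) : x ∈ mClos Eᶜ := by
  by_contra hx
  obtain ⟨δ, hδ, h2⟩ := not_mem_mClos_iff.1 hx (cc n) (cc_pos n)
  set r := min ρ δ / 2 with hr
  have hr0 : 0 < r := by positivity
  have hm : 0 < min ρ δ := by positivity
  have h3 := h r hr0 (by have := min_le_left ρ δ; linarith)
  have h4 := h2 r hr0 (by have := min_le_right ρ δ; linarith)
  have h5 := vol_split_s12 hE x hr0.le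
  have h6 := cc_lt n
  have h7 : (1 : ℝ) ≤ 5 ^ (n + 1) := one_le_pow₀ (by norm_num)
  have h8 := cc_pos n
  have h9 : 0 < r ^ (n + 1) := by positivity
  have h10 : cc n ≤ cc n * 5 ^ (n + 1) := by nlinarith
  nlinarith

lemma mClos_cover {n : ℕ} {E : Set (V n)} (hE : MeasurableSet E) {x : V n}
    (h : x ∉ mClos E) : x ∈ mClos Eᶜ := by
  obtain ⟨k, hk⟩ := exists_Gd h (cc_pos n)
  exact Gd_mem hE (by positivity) hk

lemma null_out {n : ℕ} {E : Set (V n)} (hE : MeasurableSet E) :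
    volume ((mClos Eᶜ)ᶜ \ E) = 0 := by
  have := ae_not_mem_mClos_compl hE.compl
  rw [compl_compl] at this
  refine measure_mono_null ?_ (ae_iff.1 this)
  rintro x ⟨hx, hxE⟩
  simp only [mem_ofPred_eq, Classical.not_imp, not_not]
  exact ⟨hxE, by by_contra h; exact hx (mClos_cover hE h)⟩

lemma ae_no_bad {n : ℕ} {E : Set (V n)} (hE : MeasurableSet E) {v : V n} (hv : ‖v‖ = 1) :
    ∀ᵐ y : V n, ∀ t : ℝ, y + t • v ∉ mClos E → ∀ δ > (0 : ℝ),
      ¬ (∀ s : ℝ, 0 < s → s < δ → y + t • v + s • v ∉ mClos Eᶜ) := by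
  have h : ∀ k m : ℕ, ∀ᵐ y : V n, ¬ ∃ t : ℝ, y + t • v ∈ Gd E (cc n) (1 / (k + 1)) ∧
      (∀ s, 0 < s → s < (1 / ((m : ℝ) + 1)) → y + t • v + s • v ∈ (mClos Eᶜ)ᶜ) := by
    intro k m
    rw [ae_iff]
    simp only [not_not]
    exact null_bad (null_out hE) (cc_lt n) (by positivity) (by positivity) hv
  have h' := ae_all_iff.2 fun k => ae_all_iff.2 fun m => h k m
  filter_upwards [h'] with y hy t ht δ hδ hs
  obtain ⟨k, hk⟩ := exists_Gd ht (cc_pos n)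
  obtain ⟨m, hm⟩ := exists_nat_one_div_lt hδ
  exact hy k m ⟨t, hk, fun s h0 h1 => hs s h0 (h1.trans hm)⟩

lemma line_unit {n : ℕ} {E : Set (V n)} (hE : MeasurableSet E) {v : V n} (hv : ‖v‖ = 1)
    {L : ℝ} (hL : 0 ≤ L) :
    ∀ᵐ x : V n, x ∉ mClos Eᶜ → x + L • v ∉ mClos E → ∃ t ∈ Icc 0 L, x + t • v ∈ mBdry E := by
  have hv' : ‖-v‖ = 1 := by rwa [norm_neg]
  have b1 := ae_no_bad hE hv
  have b2 := ae_no_bad hE hv'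
  have b3 := ae_no_bad hE.compl hv
  have b4 := ae_no_bad hE.compl hv'
  rw [compl_compl] at b3 b4
  filter_upwards [b1, b2, b3, b4] with x b1 b2 b3 b4 hx0 hxL
  by_contra hcon
  push Not at hcon
  have hcont : Continuous fun t : ℝ => x + t • v := by fun_prop
  have hdisj : ∀ y, y ∉ mClos E → y ∉ mClos Eᶜ → False := fun y h1 h2 => h2 (mClos_cover hE h1)
  refine baire_line (A := {t | x + t • v ∉ mClos Eᶜ}) (B := {t | x + t • v ∉ mClos E})
    (A' := fun k => (fun t : ℝ => x + t • v) ⁻¹' Gd Eᶜ (cc n) (1 / (k + 1)))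
    (B' := fun k => (fun t : ℝ => x + t • v) ⁻¹' Gd E (cc n) (1 / (k + 1)))
    (a := 0) (b := L) ?_ ?_ ?_ ?_ ?_ ?_ ?_ ?_ ?_ ?_ ?_ ?_ (by simpa using hx0) hxL hL
  · intro t ht
    by_contra h
    simp only [mem_union, mem_ofPred_eq, not_or, not_not] at h
    exact hcon t ht ⟨h.2, h.1⟩
  · rw [disjoint_left]
    intro t h1 h2
    exact hdisj _ h2 h1
  · exact fun k => (isClosed_Gd _ _ _).preimage hcont
  · exact fun k => (isClosed_Gd _ _ _).preimage hcont
  · rintro t ⟨h, -⟩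
    exact mem_iUnion.2 (exists_Gd h (cc_pos n))
  · rintro t ⟨h, -⟩
    exact mem_iUnion.2 (exists_Gd h (cc_pos n))
  · rintro k t ⟨h, ht⟩ h3
    have h2 := Gd_mem hE.compl (by positivity) h
    rw [compl_compl] at h2
    exact hcon t ht ⟨h2, h3⟩
  · rintro k t ⟨h, ht⟩ h3
    have h2 := Gd_mem hE (by positivity) h
    exact hcon t ht ⟨h3, h2⟩
  · intro p hp q hpq hsub
    refine b3 p hp (q - p) (by linarith) fun s h0 h1 => ?_
    have := hsub (show p + s ∈ Ioo p q from ⟨by linarith, by linarith⟩)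
    rw [show x + p • v + s • v = x + (p + s) • v by module]
    exact this
  · intro p hp q hpq hsub
    refine b4 (-p) (by rw [show x + (-p) • (-v) = x + p • v by module]; exact hp) (p - q)
      (by linarith) fun s h0 h1 => ?_
    have := hsub (show p - s ∈ Ioo q p from ⟨by linarith, by linarith⟩)
    rw [show x + (-p) • (-v) + s • (-v) = x + (p - s) • v by module]
    exact this
  · intro p hp q hpq hsub
    refine b1 p hp (q - p) (by linarith) fun s h0 h1 => ?_
    have := hsub (show p + s ∈ Ioo p q from ⟨by linarith, by linarith⟩)
    rw [show x + p • v + s • v = x + (p + s) • v by module]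
    exact this
  · intro p hp q hpq hsub
    refine b2 (-p) (by rw [show x + (-p) • (-v) = x + p • v by module]; exact hp) (p - q)
      (by linarith) fun s h0 h1 => ?_
    have := hsub (show p - s ∈ Ioo q p from ⟨by linarith, by linarith⟩)
    rw [show x + (-p) • (-v) + s • (-v) = x + (p - s) • v by module]
    exact this

lemma line_lemma {n : ℕ} {E : Set (V n)} (hE : MeasurableSet E) (h : V n) :
    ∀ᵐ x : V n, x ∈ E → x + h ∈ Eᶜ → ∃ t ∈ Icc (0 : ℝ) 1, x + t • h ∈ mBdry E := by
  by_cases h0 : h = 0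
  · subst h0
    refine Eventually.of_forall fun x h1 h2 => ?_
    rw [add_zero] at h2
    exact absurd h1 h2
  have hn : 0 < ‖h‖ := norm_pos_iff.2 h0
  have hv : ‖(‖h‖⁻¹ • h)‖ = 1 := by
    rw [norm_smul, norm_inv, norm_norm, inv_mul_cancel₀ hn.ne']
  have e1 := ae_not_mem_mClos_compl hE
  have e2 := ae_not_mem_mClos_compl hE.compl
  rw [compl_compl] at e2
  have e3 := (measurePreserving_add_right (volume : Measure (V n)) h).quasiMeasurePreserving.ae e2
  filter_upwards [e1, e3, line_unit hE hv hn.le] with x e1 e3 e4 hx hxh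
  have e5 : ‖h‖ • ‖h‖⁻¹ • h = h := by rw [smul_smul, mul_inv_cancel₀ hn.ne', one_smul]
  obtain ⟨t, ht, hb⟩ := e4 (e1 hx) (by rw [e5]; exact e3 hxh)
  refine ⟨t / ‖h‖, ⟨by have := ht.1; positivity, ?_⟩, ?_⟩
  · rw [div_le_one hn]; exact ht.2
  · rwa [smul_smul, ← div_eq_mul_inv] at hb

lemma tube_piece_aux {n : ℕ} {h : V n} {R : ℝ} (hh : ‖h‖ ≤ 2 * R)
    {s : Set (V n)} {ρ : ℝ} (hρ : 0 < ρ) (hρR : ρ ≤ 2 * R)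
    (hs : ∀ y ∈ s, ∀ z ∈ s, dist y z ≤ ρ) :
    volume {x : V n | ∃ t ∈ Icc (0 : ℝ) 1, x + t • h ∈ s} ≤
      ENNReal.ofReal (8 * 2 ^ (n + 1) * om n * R * ρ ^ n) := by
  have hom := om_pos n
  rcases s.eq_empty_or_nonempty with rfl | ⟨y0, hy0⟩
  · simp
  set N : ℕ := ⌈‖h‖ / ρ⌉₊ + 1 with hN
  have hN0 : (0 : ℝ) < N := by rw [hN]; positivity
  have hN1 : ‖h‖ ≤ ρ * N := by
    have := Nat.le_ceil (‖h‖ / ρ)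
    rw [div_le_iff₀ hρ] at this
    rw [hN]; push_cast; nlinarith
  have hN2 : ((N : ℝ) + 1) * ρ ≤ 8 * R := by
    have := Nat.ceil_lt_add_one (show 0 ≤ ‖h‖ / ρ by positivity)
    have h2 : (N : ℝ) < ‖h‖ / ρ + 2 := by rw [hN]; push_cast; linarith
    have h3 : (N : ℝ) * ρ < ‖h‖ + 2 * ρ := by
      calc (N : ℝ) * ρ < (‖h‖ / ρ + 2) * ρ := by gcongr
        _ = _ := by field_simp
    nlinarith
  have hsub : {x : V n | ∃ t ∈ Icc (0 : ℝ) 1, x + t • h ∈ s} ⊆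
      ⋃ i ∈ Finset.range (N + 1), closedBall (y0 - ((i : ℝ) / N) • h) (2 * ρ) := by
    rintro x ⟨t, ht, hx⟩
    simp only [mem_iUnion, Finset.mem_range, exists_prop]
    refine ⟨⌊t * N⌋₊, ?_, ?_⟩
    · rw [Nat.lt_succ_iff]
      apply Nat.floor_le_of_le
      nlinarith [ht.2]
    · have h1 := Nat.floor_le (show 0 ≤ t * N by have := ht.1; positivity)
      have h2 := Nat.lt_floor_add_one (t * N)
      have h3 : |t - (⌊t * N⌋₊ : ℝ) / N| ≤ 1 / N := by
        rw [abs_le]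
        constructor
        · have : (⌊t * N⌋₊ : ℝ) / N ≤ t := by rwa [div_le_iff₀ hN0]
          have : 0 < 1 / (N : ℝ) := by positivity
          linarith
        · have : t ≤ ((⌊t * N⌋₊ : ℝ) + 1) / N := by rw [le_div_iff₀ hN0]; exact h2.le
          rw [add_div] at this
          linarith
      rw [mem_closedBall, dist_eq_norm]
      have e : x - (y0 - ((⌊t * N⌋₊ : ℝ) / N) • h) =
        (x + t • h - y0) - (t - (⌊t * N⌋₊ : ℝ) / N) • h := by module
      rw [e]
      have h4 := hs _ hx _ hy0
      rw [dist_eq_norm] at h4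
      calc _ ≤ ‖x + t • h - y0‖ + ‖(t - (⌊t * N⌋₊ : ℝ) / N) • h‖ := norm_sub_le _ _
        _ ≤ ρ + 1 / N * ‖h‖ := by
          rw [norm_smul, Real.norm_eq_abs]; gcongr
        _ ≤ ρ + ρ := by
          gcongr
          rw [one_div_mul_eq_div, div_le_iff₀ hN0]; exact hN1
        _ = _ := by ring
  calc _ ≤ _ := measure_mono hsub
    _ ≤ ∑ i ∈ Finset.range (N + 1), volume (closedBall (y0 - ((i : ℝ) / N) • h) (2 * ρ)) :=
      measure_biUnion_finset_le _ _
    _ = (N + 1 : ℕ) * ENNReal.ofReal ((2 * ρ) ^ (n + 1) * om n) := by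
      simp_rw [vol_closedBall _ (show 0 ≤ 2 * ρ by positivity)]
      simp
    _ = ENNReal.ofReal (((N : ℝ) + 1) * ((2 * ρ) ^ (n + 1) * om n)) := by
      rw [ENNReal.ofReal_mul (p := (N : ℝ) + 1) (by positivity), ← ENNReal.ofReal_natCast]; push_cast; rfl
    _ ≤ _ := by
      apply ENNReal.ofReal_le_ofReal
      calc ((N : ℝ) + 1) * ((2 * ρ) ^ (n + 1) * om n) =
            (((N : ℝ) + 1) * ρ) * (2 ^ (n + 1) * om n * ρ ^ n) := by ring
        _ ≤ (8 * R) * (2 ^ (n + 1) * om n * ρ ^ n) := by gcongr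
        _ = _ := by ring

lemma tube_piece {n : ℕ} {h : V n} {R : ℝ} (hR : 0 < R) (hh : ‖h‖ ≤ 2 * R)
    {s : Set (V n)} (hs : ediam s ≤ ENNReal.ofReal R) :
    volume {x : V n | ∃ t ∈ Icc (0 : ℝ) 1, x + t • h ∈ s} ≤
      ENNReal.ofReal (8 * 2 ^ (n + 1) * om n * R) * ediam s ^ (n : ℝ) := by
  have hom := om_pos n
  have hfin : ediam s ≠ ⊤ := (hs.trans_lt ENNReal.ofReal_lt_top).ne
  set δ := (ediam s).toReal with hδ
  have hδR : δ ≤ R := ENNReal.toReal_le_of_le_ofReal hR.le hs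
  have hδ0 : 0 ≤ δ := ENNReal.toReal_nonneg
  have e : ENNReal.ofReal (8 * 2 ^ (n + 1) * om n * R) * ediam s ^ (n : ℝ) =
      ENNReal.ofReal (8 * 2 ^ (n + 1) * om n * R * δ ^ n) := by
    rw [ENNReal.ofReal_mul (p := 8 * 2 ^ (n + 1) * om n * R) (by positivity), ENNReal.rpow_natCast,
      ENNReal.ofReal_pow hδ0, hδ, ENNReal.ofReal_toReal hfin]
  rw [e]
  have h2 : Tendsto (fun ρ : ℝ => ENNReal.ofReal (8 * 2 ^ (n + 1) * om n * R * ρ ^ n))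
      (nhdsWithin δ (Ioi δ)) (nhds (ENNReal.ofReal (8 * 2 ^ (n + 1) * om n * R * δ ^ n))) := by
    apply Tendsto.mono_left _ nhdsWithin_le_nhds
    exact (ENNReal.continuous_ofReal.comp (by fun_prop :
      Continuous fun ρ : ℝ => 8 * 2 ^ (n + 1) * om n * R * ρ ^ n)).tendsto δ
  refine ge_of_tendsto h2 ?_
  filter_upwards [Ioo_mem_nhdsGT (show δ < 2 * R by linarith)] with ρ hρ
  refine tube_piece_aux hh (hδ0.trans_lt hρ.1) hρ.2.le fun y hy z hz => ?_
  exact (dist_le_diam_of_mem' hfin hy hz).trans hρ.1.le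

lemma tube {n : ℕ} {h : V n} {R : ℝ} (hR : 0 < R) (hh : ‖h‖ ≤ 2 * R) (A : Set (V n)) :
    volume {x : V n | ∃ t ∈ Icc (0 : ℝ) 1, x + t • h ∈ A} ≤
      ENNReal.ofReal (8 * 2 ^ (n + 1) * om n * R) * μH[(n : ℝ)] A := by
  have hom := om_pos n
  let ν : OuterMeasure (V n) :=
    { measureOf := fun A => volume {x : V n | ∃ t ∈ Icc (0 : ℝ) 1, x + t • h ∈ A}
      empty := by simp
      mono := by
        intro A B hAB
        apply measure_mono
        rintro x ⟨t, ht, hx⟩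
        exact ⟨t, ht, hAB hx⟩
      iUnion_nat := by
        intro s _
        refine le_trans (measure_mono ?_) (measure_iUnion_le _)
        rintro x ⟨t, ht, hx⟩
        obtain ⟨i, hi⟩ := mem_iUnion.1 hx
        exact mem_iUnion.2 ⟨i, t, ht, hi⟩ }
  have h1 : ν ≤ OuterMeasure.mkMetric
      (ENNReal.ofReal (8 * 2 ^ (n + 1) * om n * R) • fun r : ℝ≥0∞ => r ^ (n : ℝ)) :=
    OuterMeasure.le_mkMetric _ ν (ENNReal.ofReal R) (by simpa using hR)
      fun s hs => tube_piece hR hh hs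
  have hpos : 0 < 8 * 2 ^ (n + 1) * om n * R := by positivity
  rw [OuterMeasure.mkMetric_smul _ ENNReal.ofReal_ne_top (by simpa using hpos)] at h1
  have h2 := h1 A
  rw [smul_apply, OuterMeasure.coe_mkMetric] at h2
  exact h2

/-- crude Poincare inequality in a ball -/
lemma poincare {n : ℕ} {E : Set (V n)} (hE : MeasurableSet E) (z : V n) {R : ℝ} (hR : 0 < R) :
    volume (ball z R ∩ E) * volume (ball z R ∩ Eᶜ) ≤
      ENNReal.ofReal (8 * 4 ^ (n + 1) * om n ^ 2 * R ^ (n + 2)) *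
        μH[(n : ℝ)] (mBdry E ∩ ball z R) := by
  have hom := om_pos n
  set A := ball z R ∩ E with hA
  set D := ball z R ∩ Eᶜ with hD
  have hAm : MeasurableSet A := measurableSet_ball.inter hE
  have hDm : MeasurableSet D := measurableSet_ball.inter hE.compl
  -- bound for fixed h
  have key : ∀ h : V n, volume (A ∩ (fun x => x + h) ⁻¹' D) ≤
      (closedBall (0 : V n) (2 * R)).indicator (fun _ =>
        ENNReal.ofReal (8 * 2 ^ (n + 1) * om n * R) * μH[(n : ℝ)] (mBdry E ∩ ball z R)) h := by
    intro h
    by_cases hh : h ∈ closedBall (0 : V n) (2 * R)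
    · rw [indicator_of_mem hh]
      rw [mem_closedBall, dist_zero_right] at hh
      refine le_trans (measure_mono_ae ?_) (tube hR hh _)
      filter_upwards [line_lemma hE h] with x hx hxA
      obtain ⟨⟨hxb, hxE⟩, hxb', hxE'⟩ := hxA
      obtain ⟨t, ht, htb⟩ := hx hxE hxE'
      refine ⟨t, ht, htb, ?_⟩
      have := (convex_ball z R).add_smul_sub_mem hxb hxb' ht
      simpa using this
    · rw [indicator_of_notMem hh]
      rw [nonpos_iff_eq_zero]
      convert measure_empty (μ := (volume : Measure (V n)))
      rw [eq_empty_iff_forall_notMem]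
      rintro x ⟨⟨hxb, hxE⟩, hxb', hxE'⟩
      apply hh
      rw [mem_closedBall, dist_zero_right]
      rw [mem_ball] at hxb hxb'
      have : ‖h‖ = dist (x + h) x := by simp [dist_eq_norm]
      rw [this]
      have := dist_triangle_right (x + h) x z
      linarith
  have hint : ∫⁻ h : V n, volume (A ∩ (fun x => x + h) ⁻¹' D) = volume A * volume D := by
    have e1 : ∀ h : V n, volume (A ∩ (fun x => x + h) ⁻¹' D) =
        ∫⁻ x : V n, A.indicator 1 x * D.indicator 1 (x + h) := by
      intro h
      rw [← lintegral_indicator_one (hAm.inter (measurable_add_const h hDm))]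
      congr 1
      ext x
      by_cases h1 : x ∈ A <;> by_cases h2 : x + h ∈ D <;> simp [h1, h2, indicator]
    simp_rw [e1]
    rw [lintegral_lintegral_swap]
    · have e2 : ∀ x : V n, ∫⁻ h : V n, A.indicator 1 x * D.indicator 1 (x + h) =
          A.indicator 1 x * volume D := by
        intro x
        rw [lintegral_const_mul]
        · congr 1
          rw [lintegral_add_left_eq_self (fun y => D.indicator (1 : V n → ℝ≥0∞) y) x,
            lintegral_indicator_one hDm]
        · exact (measurable_one.indicator hDm).comp (measurable_const_add x)
      simp_rw [e2]
      rw [lintegral_mul_const _ (measurable_one.indicator hAm), lintegral_indicator_one hAm]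
    · apply Measurable.aemeasurable
      apply Measurable.mul
      · exact (measurable_one.indicator hAm).comp measurable_snd
      · exact (measurable_one.indicator hDm).comp (measurable_snd.add measurable_fst)
  rw [← hint]
  calc _ ≤ _ := lintegral_mono key
    _ = ENNReal.ofReal (8 * 2 ^ (n + 1) * om n * R) * μH[(n : ℝ)] (mBdry E ∩ ball z R) *
        ENNReal.ofReal ((2 * R) ^ (n + 1) * om n) := by
      rw [lintegral_indicator_const measurableSet_closedBall,
        vol_closedBall _ (show 0 ≤ 2 * R by positivity)]
    _ = (ENNReal.ofReal (8 * 2 ^ (n + 1) * om n * R) *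
        ENNReal.ofReal ((2 * R) ^ (n + 1) * om n)) * μH[(n : ℝ)] (mBdry E ∩ ball z R) := by ring
    _ ≤ _ := by
      rw [← ENNReal.ofReal_mul (by positivity)]
      rw [show 8 * 2 ^ (n + 1) * om n * R * ((2 * R) ^ (n + 1) * om n) =
        8 * 4 ^ (n + 1) * om n ^ 2 * R ^ (n + 2) by
          rw [show (4 : ℝ) ^ (n + 1) = 2 ^ (n + 1) * 2 ^ (n + 1) by rw [← mul_pow]; norm_num]
          ring]

lemma ofReal_div_le_of {a b : ℝ} {h : ℝ≥0∞} (hb : 0 < b)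
    (H : ENNReal.ofReal a ≤ ENNReal.ofReal b * h) : ENNReal.ofReal (a / b) ≤ h := by
  rw [ENNReal.ofReal_div_of_pos hb]
  exact ENNReal.div_le_of_le_mul' H

lemma stop_ball {n : ℕ} {F : Set (V n)} (hF : MeasurableSet F) {c y : V n} {r τ : ℝ}
    (hr : 0 < r) (hy : dist y c ≤ r) (hτ : 0 < τ) (hyF : y ∉ mClos F)
    (h0 : τ * (r ^ (n + 1) * om n) ≤ volume.real (ball c r ∩ F)) :
    ∃ (w : V n) (s : ℝ), 0 < s ∧ s ≤ r ∧ dist y w * r = dist y c * s ∧ ball w s ⊆ ball c r ∧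
      τ * (s ^ (n + 1) * om n) ≤ volume.real (ball w s ∩ F) ∧
      (1 - τ) * (1 / 2) ^ (n + 1) * (s ^ (n + 1) * om n) ≤ volume.real (ball w s ∩ Fᶜ) := by
  have hom := om_pos n
  let w : ℕ → V n := fun k => y + ((1 / 2 : ℝ) ^ k) • (c - y)
  let s : ℕ → ℝ := fun k => (1 / 2 : ℝ) ^ k * r
  have hs : ∀ k, 0 < s k := fun k => by positivity
  have hdw : ∀ k, dist y (w k) = (1 / 2 : ℝ) ^ k * dist y c := by
    intro k
    simp only [w, dist_eq_norm]
    rw [show y - (y + ((1 / 2 : ℝ) ^ k) • (c - y)) = ((1 / 2 : ℝ) ^ k) • (y - c) by module,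
      norm_smul, Real.norm_of_nonneg (by positivity)]
  have hsucc : ∀ k, ball (w (k + 1)) (s (k + 1)) ⊆ ball (w k) (s k) := by
    intro k
    apply ball_subset_ball'
    have : dist (w (k + 1)) (w k) = (1 / 2 : ℝ) ^ (k + 1) * dist y c := by
      simp only [w, dist_eq_norm]
      rw [show y + ((1 / 2 : ℝ) ^ (k + 1)) • (c - y) - (y + ((1 / 2 : ℝ) ^ k) • (c - y)) =
        ((1 / 2 : ℝ) ^ (k + 1)) • (y - c) by rw [pow_succ]; module,
        norm_smul, Real.norm_of_nonneg (by positivity)]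
    rw [this]
    have h1 : (1 / 2 : ℝ) ^ (k + 1) * dist y c ≤ (1 / 2 : ℝ) ^ (k + 1) * r := by gcongr
    simp only [s]
    rw [pow_succ] at *
    linarith
  have hsub : ∀ k, ball (w k) (s k) ⊆ ball c r := by
    intro k
    induction k with
    | zero => simp [w, s]
    | succ k ih => exact (hsucc k).trans ih
  have hex : ∃ k, volume.real (ball (w k) (s k) ∩ F) < τ * ((s k) ^ (n + 1) * om n) := by
    obtain ⟨δ, hδ, H⟩ := not_mem_mClos_iff.1 hyF (τ * om n / 2 / 2 ^ (n + 1)) (by positivity)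
    obtain ⟨k, hk⟩ := exists_pow_lt_of_lt_one (show 0 < δ / (2 * r) by positivity)
      (show (1 / 2 : ℝ) < 1 by norm_num)
    refine ⟨k, ?_⟩
    have hk' : 2 * s k < δ := by
      rw [lt_div_iff₀ (by positivity)] at hk
      simp only [s]; linarith
    have h1 := H (2 * s k) (by have := hs k; positivity) hk'
    have h2 : ball (w k) (s k) ∩ F ⊆ ball y (2 * s k) ∩ F := by
      apply inter_subset_inter_left
      apply ball_subset_ball'
      rw [dist_comm, hdw]
      have : (1 / 2 : ℝ) ^ k * dist y c ≤ (1 / 2 : ℝ) ^ k * r := by gcongr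
      simp only [s]; linarith
    have h3 := measureReal_mono h2 (ball_inter_ne_top y (2 * s k) F)
    have h4 : 0 < τ * (s k ^ (n + 1) * om n) := by have := hs k; positivity
    calc _ ≤ _ := h3
      _ ≤ _ := h1
      _ = τ * (s k ^ (n + 1) * om n) / 2 := by rw [mul_pow]; field_simp
      _ < _ := by linarith
  classical
  obtain ⟨k, hk⟩ : ∃ k, Nat.find hex = k + 1 := by
    apply Nat.exists_eq_succ_of_ne_zero
    intro h
    have := Nat.find_spec hex
    rw [h] at this
    simp only [w, s, pow_zero, one_smul, one_mul, add_sub_cancel] at this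
    linarith
  have hk1 := Nat.find_spec hex
  rw [hk] at hk1
  have hk2 := Nat.find_min hex (show k < Nat.find hex by omega)
  rw [not_lt] at hk2
  refine ⟨w k, s k, hs k, ?_, ?_, hsub k, hk2, ?_⟩
  · have : (1 / 2 : ℝ) ^ k ≤ 1 := pow_le_one₀ (by norm_num) (by norm_num)
    simp only [s]; nlinarith
  · rw [hdw]; simp only [s]; ring
  · have h1 := vol_split_s12 hF (w (k + 1)) (hs (k + 1)).le
    have h2 := measureReal_mono (inter_subset_inter_left Fᶜ (hsucc k))
      (ball_inter_ne_top (w k) (s k) Fᶜ)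
    have e : s (k + 1) ^ (n + 1) * om n = (1 / 2) ^ (n + 1) * (s k ^ (n + 1) * om n) := by
      have : s (k + 1) = 1 / 2 * s k := by simp only [s]; ring
      rw [this, mul_pow]; ring
    rw [e] at h1 hk1
    linarith

lemma ball_lower {n : ℕ} {E : Set (V n)} (hE : MeasurableSet E) (z : V n) {s a b : ℝ}
    (hs : 0 < s) (ha : 0 < a) (hb : 0 < b)
    (h1 : a * (s ^ (n + 1) * om n) ≤ volume.real (ball z s ∩ E))
    (h2 : b * (s ^ (n + 1) * om n) ≤ volume.real (ball z s ∩ Eᶜ)) :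
    ENNReal.ofReal (a * b / (8 * 4 ^ (n + 1)) * s ^ n) ≤ μH[(n : ℝ)] (mBdry E ∩ ball z s) := by
  have hom := om_pos n
  have h := poincare hE z hs
  have e : a * b / (8 * 4 ^ (n + 1)) * s ^ n =
      (a * (s ^ (n + 1) * om n)) * (b * (s ^ (n + 1) * om n)) /
        (8 * 4 ^ (n + 1) * om n ^ 2 * s ^ (n + 2)) := by
    field_simp
    ring
  rw [e]
  apply ofReal_div_le_of (by positivity)
  refine le_trans ?_ h
  rw [ENNReal.ofReal_mul (by positivity)]
  rw [← ofReal_measureReal (ball_inter_ne_top z s E), ← ofReal_measureReal (ball_inter_ne_top z s Eᶜ)]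
  gcongr

lemma isoper_aux {n : ℕ} {E : Set (V n)} (hE : MeasurableSet E) (z : V n) {R θ M : ℝ}
    (hR : 0 < R) (hθ : 0 < θ) (hθ1 : θ ≤ 1 / 2) (hM : 0 < M)
    (hc : θ * (R ^ (n + 1) * om n) ≤ volume.real (ball z R ∩ Eᶜ))
    (hMe : M ^ (n + 1) * om n = 2 ^ (n + 2) * volume.real (ball z R ∩ E)) :
    ENNReal.ofReal (θ / (8 * 4 ^ (n + 1) * 2 ^ (n + 2) * 5 ^ (n + 1) * 2 ^ (n + 2)) * M ^ n) ≤
      μH[(n : ℝ)] (mBdry E ∩ ball z R) := by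
  have hom := om_pos n
  set T : Set (V n) := {y | y ∈ ball z R ∩ E ∧ y ∉ mClos Eᶜ} with hT
  have hTm : volume (ball z R ∩ E) ≤ volume T := by
    apply measure_mono_ae
    filter_upwards [ae_not_mem_mClos_compl hE] with y hy hyB
    exact ⟨hyB, hy hyB.2⟩
  have key : ∀ y : V n, ∃ (w : V n) (s : ℝ), y ∈ T → 0 < s ∧ s ≤ M ∧ y ∈ closedBall w s ∧
      ball w s ⊆ ball z R ∧ ENNReal.ofReal (θ / (8 * 4 ^ (n + 1) * 2 ^ (n + 2)) * s ^ n) ≤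
        μH[(n : ℝ)] (mBdry E ∩ ball w s) := by
    intro y
    by_cases hy : y ∈ T
    swap
    · exact ⟨0, 0, fun h => absurd h hy⟩
    have hyz : dist y z ≤ R := (mem_ball.1 hy.1.1).le
    obtain ⟨w, s, hs, hsr, hd, hsub, h1, h2⟩ := stop_ball hE.compl hR hyz hθ hy.2 hc
    rw [compl_compl] at h2
    refine ⟨w, s, fun _ => ⟨hs, ?_, ?_, hsub, ?_⟩⟩
    · have h3 := measureReal_mono (inter_subset_inter_left E hsub) (ball_inter_ne_top z R E)
      have h4 : 1 / 2 * ((1 / 2) ^ (n + 1) * (s ^ (n + 1) * om n)) ≤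
          volume.real (ball z R ∩ E) := by
        refine le_trans ?_ (h2.trans h3)
        rw [mul_assoc]; gcongr; linarith
      have h5 : s ^ (n + 1) * om n ≤ M ^ (n + 1) * om n := by
        rw [hMe]
        calc _ = 2 ^ (n + 2) * (1 / 2 * ((1 / 2) ^ (n + 1) * (s ^ (n + 1) * om n))) := by
              rw [one_div, inv_pow]; field_simp; ring
          _ ≤ _ := by gcongr
      exact le_of_pow_le_pow_left₀ (by omega) hM.le (le_of_mul_le_mul_right h5 hom)
    · rw [mem_closedBall]
      have : dist y w * R ≤ s * R := by rw [hd]; nlinarith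
      exact le_of_mul_le_mul_right this hR
    · have := ball_lower hE w hs (a := 1 / 2 * (1 / 2) ^ (n + 1)) (b := θ) (by positivity) hθ
        (by refine le_trans ?_ h2; gcongr; linarith) h1
      refine le_trans (le_of_eq ?_) this
      congr 2
      rw [one_div, inv_pow]; field_simp; ring
  choose w s hws using key
  obtain ⟨u, huT, hdisj, hcov⟩ := Vitali.exists_disjoint_subfamily_covering_enlargement_closedBall
    T w s M (fun a ha => (hws a ha).2.1) 5 (by norm_num)
  have hdisj' : u.PairwiseDisjoint fun a => ball (w a) (s a) := fun a ha b hb hab =>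
    (hdisj ha hb hab).mono ball_subset_closedBall ball_subset_closedBall
  have hcount : u.Countable := hdisj'.countable_of_isOpen (fun a _ => isOpen_ball)
    (fun a ha => nonempty_ball.2 (hws a (huT ha)).1)
  set K := θ / (8 * 4 ^ (n + 1) * 2 ^ (n + 2)) with hK
  have hKpos : 0 < K := by positivity
  have hsum : ∑' a : u, ENNReal.ofReal (K * s a ^ n) ≤ μH[(n : ℝ)] (mBdry E ∩ ball z R) := by
    calc _ ≤ ∑' a : u, (μH[(n : ℝ)].restrict (mBdry E)) (ball (w a) (s a)) := by
          apply ENNReal.tsum_le_tsum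
          intro a
          rw [Measure.restrict_apply measurableSet_ball, inter_comm]
          exact (hws a (huT a.2)).2.2.2.2
      _ = (μH[(n : ℝ)].restrict (mBdry E)) (⋃ a ∈ u, ball (w a) (s a)) :=
          (measure_biUnion hcount hdisj' fun a _ => measurableSet_ball).symm
      _ ≤ (μH[(n : ℝ)].restrict (mBdry E)) (ball z R) := by
          apply measure_mono
          exact iUnion₂_subset fun a ha => (hws a (huT ha)).2.2.2.1
      _ = _ := by rw [Measure.restrict_apply measurableSet_ball, inter_comm]
  have hvol : volume (ball z R ∩ E) ≤
      ENNReal.ofReal (5 ^ (n + 1) * om n * M / K) * μH[(n : ℝ)] (mBdry E ∩ ball z R) := by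
    calc _ ≤ volume T := hTm
      _ ≤ volume (⋃ a ∈ u, closedBall (w a) (5 * s a)) := by
          apply measure_mono
          intro y hy
          obtain ⟨b, hb, hyb⟩ := hcov y hy
          exact mem_biUnion hb (hyb (hws y hy).2.2.1)
      _ ≤ ∑' a : u, volume (closedBall (w a) (5 * s a)) := measure_biUnion_le _ hcount _
      _ ≤ ∑' a : u, ENNReal.ofReal (5 ^ (n + 1) * om n * M / K) * ENNReal.ofReal (K * s a ^ n) := by
          apply ENNReal.tsum_le_tsum
          intro a
          obtain ⟨hs0, hsM, -⟩ := hws a (huT a.2)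
          rw [vol_closedBall _ (by positivity), ← ENNReal.ofReal_mul (by positivity)]
          apply ENNReal.ofReal_le_ofReal
          calc (5 * s a) ^ (n + 1) * om n = 5 ^ (n + 1) * om n * s a * s a ^ n := by
                rw [mul_pow]; ring
            _ ≤ 5 ^ (n + 1) * om n * M * s a ^ n := by gcongr
            _ = _ := by field_simp
      _ = ENNReal.ofReal (5 ^ (n + 1) * om n * M / K) * ∑' a : u, ENNReal.ofReal (K * s a ^ n) :=
          ENNReal.tsum_mul_left
      _ ≤ _ := by gcongr
  rw [← ofReal_measureReal (ball_inter_ne_top z R E)] at hvol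
  have := ofReal_div_le_of (by positivity) hvol
  refine le_trans (le_of_eq ?_) this
  congr 1
  have e : volume.real (ball z R ∩ E) = M ^ (n + 1) * om n / 2 ^ (n + 2) := by
    rw [hMe]; field_simp
  rw [e, hK]
  field_simp
  ring

noncomputable def ci (n : ℕ) : ℝ :=
  (1 / 2) ^ (n + 3) / (8 * 4 ^ (n + 1) * 2 ^ (n + 2) * 5 ^ (n + 1) * 2 ^ (n + 2))

lemma ci_pos (n : ℕ) : 0 < ci n := by unfold ci; positivity

lemma isoper {n : ℕ} {E : Set (V n)} (hE : MeasurableSet E) (z : V n) {R M : ℝ}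
    (hR : 0 < R) (hM : 0 < M)
    (hc : (1 / 2) ^ (n + 3) * (R ^ (n + 1) * om n) ≤ volume.real (ball z R ∩ Eᶜ))
    (hMe : M ^ (n + 1) * om n ≤ 2 ^ (n + 2) * volume.real (ball z R ∩ E)) :
    ENNReal.ofReal (ci n * M ^ n) ≤ μH[(n : ℝ)] (mBdry E ∩ ball z R) := by
  have hom := om_pos n
  have hci := ci_pos n
  set X := 2 ^ (n + 2) * volume.real (ball z R ∩ E) / om n with hX
  have hX1 : M ^ (n + 1) ≤ X := by rw [hX, le_div_iff₀ hom]; exact hMe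
  have hX0 : 0 < X := lt_of_lt_of_le (by positivity) hX1
  set M' := X ^ (((n + 1 : ℕ) : ℝ)⁻¹) with hM'
  have e : M' ^ (n + 1) = X := Real.rpow_inv_natCast_pow hX0.le (by omega)
  have hM'0 : 0 < M' := Real.rpow_pos_of_pos hX0 _
  have hMM : M ≤ M' := le_of_pow_le_pow_left₀ (n := n + 1) (by omega) hM'0.le (by rw [e]; exact hX1)
  have := isoper_aux hE z hR (θ := (1 / 2) ^ (n + 3)) (M := M') (by positivity)
    (by
      have : (1 / 2 : ℝ) ^ (n + 3) ≤ (1 / 2) ^ 1 :=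
        pow_le_pow_of_le_one (by norm_num) (by norm_num) (by omega)
      simpa using this) hM'0 hc (by rw [e, hX]; field_simp)
  refine le_trans ?_ this
  apply ENNReal.ofReal_le_ofReal
  unfold ci at *
  gcongr

lemma coord_bound {n : ℕ} {e w : V n} (he : ‖e‖ = 1) {m : ℝ} {i : Fin (n + 1)}
    (hi : ∀ j, |e j| ≤ |e i|) (hm : ∀ j, j ≠ i → |w j| ≤ m) (hm0 : 0 ≤ m)
    (hw : |inner ℝ w e| ≤ 2 * (1 / (4 * (n + 1))) * ‖w‖) : ‖w‖ ≤ 5 * (n + 1) ^ 2 * m := by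
  have he1 : ∀ j, |e j| ≤ 1 := by
    intro j
    have := PiLp.norm_apply_le e j
    rwa [he, Real.norm_eq_abs] at this
  have hei : 1 ≤ (n + 1) * |e i| := by
    have h1 : ∑ j, (e j) ^ 2 = 1 := by
      have := EuclideanSpace.real_norm_sq_eq e
      rw [he] at this; linarith
    calc (1 : ℝ) = ∑ j, (e j) ^ 2 := h1.symm
      _ ≤ ∑ j : Fin (n + 1), |e i| := by
        apply Finset.sum_le_sum
        intro j _
        rw [← sq_abs]
        have := hi j
        have := he1 j
        have := abs_nonneg (e j)
        nlinarith
      _ = _ := by simp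
  have hcard : ∀ f : Fin (n + 1) → ℝ, (∀ j, j ≠ i → |f j| ≤ m) →
      |∑ j ∈ Finset.univ.erase i, f j| ≤ n * m := by
    intro f hf
    calc _ ≤ ∑ j ∈ Finset.univ.erase i, |f j| := Finset.abs_sum_le_sum_abs _ _
      _ ≤ ∑ j ∈ Finset.univ.erase i, m := by
        apply Finset.sum_le_sum
        intro j hj
        exact hf j (Finset.ne_of_mem_erase hj)
      _ = _ := by simp
  have hwn : ‖w‖ ≤ |w i| + n * m := by
    have h1 : ‖w‖ ^ 2 ≤ (|w i| + n * m) ^ 2 := by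
      rw [EuclideanSpace.real_norm_sq_eq, ← Finset.add_sum_erase _ _ (Finset.mem_univ i)]
      have h2 : ∑ j ∈ Finset.univ.erase i, (w j) ^ 2 ≤
          ∑ j ∈ Finset.univ.erase i, m * |w j| := by
        apply Finset.sum_le_sum
        intro j hj
        rw [← sq_abs]
        have := hm j (Finset.ne_of_mem_erase hj)
        have := abs_nonneg (w j)
        nlinarith
      have h3 := hcard (fun j => |w j|) (fun j hj => by rw [abs_abs]; exact hm j hj)
      have h4 := le_of_abs_le h3
      rw [← Finset.mul_sum] at h2
      have h5 : m * ∑ j ∈ Finset.univ.erase i, |w j| ≤ m * (n * m) := by gcongr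
      have h6 : m * (n * m) ≤ (n * m) ^ 2 := by
        rcases Nat.eq_zero_or_pos n with h | h
        · simp [h]
        · have : (1 : ℝ) ≤ n := by exact_mod_cast h
          have : 0 ≤ n * m ^ 2 * (n - 1) := by
            have : (0 : ℝ) ≤ n - 1 := by linarith
            positivity
          nlinarith
      have h7 := sq_abs (w i)
      have : 0 ≤ |w i| * (n * m) := by positivity
      nlinarith
    exact le_of_pow_le_pow_left₀ two_ne_zero (by positivity) h1
  have hin : |e i| * |w i| ≤ |inner ℝ w e| + n * m := by
    have h1 : (inner ℝ w e : ℝ) = w i * e i + ∑ j ∈ Finset.univ.erase i, w j * e j := by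
      rw [Finset.add_sum_erase _ (fun j => w j * e j) (Finset.mem_univ i), PiLp.inner_apply]
      apply Finset.sum_congr rfl
      intro j _
      simp [mul_comm]
    have h2 := hcard (fun j => w j * e j) (fun j hj => by
      rw [abs_mul]
      have := hm j hj
      have := he1 j
      have := abs_nonneg (w j)
      have := abs_nonneg (e j)
      nlinarith)
    rw [← abs_mul, mul_comm (e i), show w i * e i = inner ℝ w e -
      ∑ j ∈ Finset.univ.erase i, w j * e j by rw [h1]; ring]
    exact (abs_sub _ _).trans (by linarith)
  have hn : (0 : ℝ) < n + 1 := by positivity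
  have h8 : |w i| ≤ (n + 1) * (|inner ℝ w e| + n * m) := by
    calc |w i| ≤ ((n + 1) * |e i|) * |w i| := by
          have := abs_nonneg (w i); nlinarith
      _ = (n + 1) * (|e i| * |w i|) := by ring
      _ ≤ _ := by gcongr
  have h9 : (n + 1) * |inner ℝ w e| ≤ 1 / 2 * ‖w‖ := by
    calc _ ≤ (n + 1) * (2 * (1 / (4 * (n + 1))) * ‖w‖) := by gcongr
      _ = _ := by field_simp; norm_num
  have h10 : (0 : ℝ) ≤ n := by positivity
  nlinarith [mul_nonneg h10 hm0, mul_nonneg (mul_nonneg h10 h10) hm0]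

lemma graph_piece {n : ℕ} {T : Set (V n)} {e z : V n} {r : ℝ} (he : ‖e‖ = 1) (hr : 0 ≤ r)
    (hT : T ⊆ closedBall z r)
    (h : ∀ x ∈ T, ∀ y ∈ T, |inner ℝ (x - y) e| ≤ 2 * (1 / (4 * (n + 1))) * ‖x - y‖) :
    μH[(n : ℝ)] T ≤ ENNReal.ofReal ((5 * (n + 1) ^ 2) ^ n * (2 * r) ^ n) := by
  obtain ⟨i, -, hi⟩ := Finset.exists_max_image Finset.univ (fun j => |e j|)
    ⟨(0 : Fin (n + 1)), Finset.mem_univ _⟩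
  let P : V n → (Fin n → ℝ) := fun x j => x (i.succAbove j)
  have hP : ∀ x y : V n, ∀ j, |(x - y) (i.succAbove j)| ≤ dist (P x) (P y) := by
    intro x y j
    have := dist_le_pi_dist (P x) (P y) j
    rwa [Real.dist_eq] at this
  let f : T → (Fin n → ℝ) := fun x => P x
  have hf : AntilipschitzWith (5 * ((n : NNReal) + 1) ^ 2) f := by
    apply AntilipschitzWith.of_le_mul_dist
    intro x y
    have := coord_bound (w := (x : V n) - (y : V n)) he (m := dist (f x) (f y)) (i := i)
      (fun j => hi j (Finset.mem_univ j)) (by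
        intro j hj
        obtain ⟨k, rfl⟩ := Fin.exists_succAbove_eq hj
        exact hP x y k) dist_nonneg (h x x.2 y y.2)
    rw [Subtype.dist_eq, dist_eq_norm]
    simpa using this
  have h1 := hf.le_hausdorffMeasure_image (d := n) (by positivity) univ
  have h2 : μH[(n : ℝ)] (univ : Set T) = μH[(n : ℝ)] T := by
    rw [← (isometry_subtype_coe (s := T)).hausdorffMeasure_image (Or.inl (by positivity))]
    simp
  have h3 : f '' univ ⊆ closedBall (P z) r := by
    rintro _ ⟨x, -, rfl⟩
    rw [mem_closedBall, dist_pi_le_iff hr]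
    intro j
    have := mem_closedBall.1 (hT x.2)
    rw [dist_eq_norm] at this
    have h4 := PiLp.norm_apply_le ((x : V n) - z) (i.succAbove j)
    rw [dist_eq_norm]
    exact h4.trans this
  have h5 : μH[(n : ℝ)] (f '' univ) ≤ ENNReal.ofReal ((2 * r) ^ n) := by
    refine (measure_mono h3).trans ?_
    have := hausdorffMeasure_pi_real (ι := Fin n)
    rw [Fintype.card_fin] at this
    rw [this, Real.volume_pi_closedBall _ hr, Fintype.card_fin]
  rw [h2] at h1
  refine h1.trans ?_
  rw [ENNReal.ofReal_mul (by positivity), ENNReal.rpow_natCast]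
  gcongr
  rw [ENNReal.ofReal_pow (by positivity)]
  gcongr
  rw [ENNReal.ofReal]
  simp only [ENNReal.coe_le_coe]
  apply le_of_eq
  ext
  rw [Real.coe_toNNReal _ (by positivity)]
  push_cast
  rfl

lemma inner_est {n : ℕ} {x y c e : V n} {r ρ ε : ℝ} (hρ : 0 < ρ) (hr : ρ ≤ r)
    (hx : dist x c = r) (hy : r ≤ dist y c) (hxy : dist x y ≤ 2 * ε * ρ)
    (he : ‖r⁻¹ • (x - c) - e‖ ≤ ε) : -(2 * ε * ‖x - y‖) ≤ inner ℝ (y - x) e := by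
  have hr0 : 0 < r := by linarith
  rw [dist_eq_norm] at hx hy hxy
  have h1 : ‖y - c‖ ^ 2 = ‖y - x‖ ^ 2 + 2 * inner ℝ (y - x) (x - c) + ‖x - c‖ ^ 2 := by
    rw [← norm_add_sq_real]; congr 2; abel
  have h2 : r ^ 2 ≤ ‖y - c‖ ^ 2 := by gcongr
  rw [h1, hx] at h2
  have hn : ‖y - x‖ = ‖x - y‖ := norm_sub_rev _ _
  have h3 : inner ℝ (y - x) e = r⁻¹ * inner ℝ (y - x) (x - c) -
      inner ℝ (y - x) (r⁻¹ • (x - c) - e) := by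
    rw [inner_sub_right (y - x) (r⁻¹ • (x - c)) e, inner_smul_right]; ring
  have h4 : |inner ℝ (y - x) (r⁻¹ • (x - c) - e)| ≤ ‖x - y‖ * ε := by
    refine (abs_real_inner_le_norm _ _).trans ?_
    rw [hn]; gcongr
  have h5 := le_of_abs_le h4
  have h6 : -(ε * ‖x - y‖) ≤ r⁻¹ * inner ℝ (y - x) (x - c) := by
    rw [inv_mul_eq_div, le_div_iff₀ hr0]
    rw [hn] at h2
    have h7 : ‖x - y‖ * ‖x - y‖ ≤ 2 * ε * ρ * ‖x - y‖ := by gcongr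
    have h8 : 0 ≤ ε := (norm_nonneg _).trans he
    have h9 : ε * ‖x - y‖ * ρ ≤ ε * ‖x - y‖ * r := by gcongr
    nlinarith
  rw [h3]
  linarith

lemma lip_bdry (n : ℕ) (K : ℝ) (hK : 0 ≤ K) : ∃ C : ℝ, 0 ≤ C ∧ ∀ (S : Set (V n)) (z : V n) (ρ : ℝ), 0 < ρ →
    S ⊆ closedBall z (K * ρ) →
    (∀ x ∈ S, ∃ (c : V n) (r : ℝ), ρ ≤ r ∧ dist x c = r ∧ Disjoint (ball c r) S) →
    μH[(n : ℝ)] S ≤ ENNReal.ofReal (C * ρ ^ n) := by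
  set ε : ℝ := 1 / (4 * (n + 1)) with hε
  have hε0 : 0 < ε := by positivity
  obtain ⟨t1, ht1, ht1f, hcov1⟩ := (isCompact_sphere (0 : V n) 1).finite_cover_balls hε0
  obtain ⟨t2, ht2, ht2f, hcov2⟩ := (isCompact_closedBall (0 : V n) K).finite_cover_balls hε0
  lift t1 to Finset (V n) using ht1f
  lift t2 to Finset (V n) using ht2f
  refine ⟨t1.card * t2.card * ((5 * (n + 1) ^ 2) ^ n * (2 * K) ^ n), by positivity, ?_⟩
  intro S z ρ hρ hSz hS
  choose! c r hr hd hdis using hS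
  let T : V n → V n → Set (V n) := fun e q =>
    {x | x ∈ S ∧ ‖(r x)⁻¹ • (x - c x) - e‖ ≤ ε ∧ ‖ρ⁻¹ • (x - z) - q‖ ≤ ε}
  have hcov : S ⊆ ⋃ p ∈ t1 ×ˢ t2, T p.1 p.2 := by
    intro x hx
    have hr0 : 0 < r x := by linarith [hr x hx]
    have h1 : (r x)⁻¹ • (x - c x) ∈ sphere (0 : V n) 1 := by
      rw [mem_sphere, dist_zero_right, norm_smul, ← dist_eq_norm, hd x hx, norm_inv,
        Real.norm_of_nonneg hr0.le]
      field_simp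
    have h2 : ρ⁻¹ • (x - z) ∈ closedBall (0 : V n) K := by
      rw [mem_closedBall, dist_zero_right, norm_smul, ← dist_eq_norm, norm_inv,
        Real.norm_of_nonneg hρ.le, inv_mul_le_iff₀ hρ, mul_comm]
      exact hSz hx
    obtain ⟨e, he, he'⟩ := mem_iUnion₂.1 (hcov1 h1)
    obtain ⟨q, hq, hq'⟩ := mem_iUnion₂.1 (hcov2 h2)
    refine mem_iUnion₂.2 ⟨(e, q), Finset.mem_product.2 ⟨he, hq⟩, hx, ?_, ?_⟩
    · rw [← dist_eq_norm]; exact (mem_ball.1 he').le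
    · rw [← dist_eq_norm]; exact (mem_ball.1 hq').le
  have hpiece : ∀ p ∈ t1 ×ˢ t2, μH[(n : ℝ)] (T p.1 p.2) ≤
      ENNReal.ofReal ((5 * (n + 1) ^ 2) ^ n * (2 * (K * ρ)) ^ n) := by
    rintro ⟨e, q⟩ hp
    have he : ‖e‖ = 1 := by
      have := ht1 (Finset.mem_product.1 hp).1
      simpa using this
    apply graph_piece he (by positivity) (fun x hx => hSz hx.1)
    have half : ∀ x ∈ T e q, ∀ y ∈ T e q, -(2 * ε * ‖x - y‖) ≤ inner ℝ (y - x) e := by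
      rintro x ⟨hx, hxe, hxq⟩ y ⟨hy, hye, hyq⟩
      apply inner_est hρ (hr x hx) (hd x hx) _ _ hxe
      · by_contra hcon
        rw [not_le] at hcon
        exact (disjoint_left.1 (hdis x hx)) (mem_ball.2 hcon) hy
      · have h1 : ‖ρ⁻¹ • (x - y)‖ ≤ 2 * ε := by
          calc _ = ‖(ρ⁻¹ • (x - z) - q) - (ρ⁻¹ • (y - z) - q)‖ := by congr 1; module
            _ ≤ _ := norm_sub_le _ _
            _ ≤ _ := by linarith
        rw [norm_smul, norm_inv, Real.norm_of_nonneg hρ.le, inv_mul_le_iff₀ hρ] at h1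
        rw [dist_eq_norm]; linarith
    intro x hx y hy
    have h1 := half x hx y hy
    have h2 := half y hy x hx
    rw [norm_sub_rev y x] at h2
    rw [← neg_sub x y, inner_neg_left] at h1
    rw [abs_le]
    constructor <;> linarith
  calc _ ≤ _ := measure_mono hcov
    _ ≤ _ := measure_biUnion_finset_le _ _
    _ ≤ _ := Finset.sum_le_sum hpiece
    _ = ENNReal.ofReal (t1.card * t2.card * ((5 * (n + 1) ^ 2) ^ n * (2 * (K * ρ)) ^ n)) := by
      rw [Finset.sum_const, Finset.card_product, nsmul_eq_mul,
        ENNReal.ofReal_mul (p := (t1.card : ℝ) * t2.card) (by positivity),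
        ENNReal.ofReal_mul (p := (t1.card : ℝ)) (by positivity)]
      simp
    _ ≤ _ := by
      apply ENNReal.ofReal_le_ofReal
      apply le_of_eq
      rw [mul_pow, mul_pow, mul_pow]; ring

noncomputable def kap (n : ℕ) : ℝ := (1 / 2) ^ (n + 4) / (n + 1)

lemma kap_pos (n : ℕ) : 0 < kap n := by unfold kap; positivity

lemma kap_lt (n : ℕ) : kap n < 1 := by
  unfold kap
  have h1 : (1 / 2 : ℝ) ^ (n + 4) < 1 := pow_lt_one₀ (by norm_num) (by norm_num) (by omega)
  have h2 : (1 : ℝ) ≤ n + 1 := by have : (0 : ℝ) ≤ n := by positivity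
                                  linarith
  rw [div_lt_one (by positivity)]
  linarith

lemma shrink {n : ℕ} {F : Set (V n)} (hF : MeasurableSet F) (w : V n) {s t : ℝ} (hs : 0 < s)
    (ht : 0 ≤ t) (ht1 : t ≤ 1) :
    volume.real (ball w s ∩ F) - (n + 1) * t * (s ^ (n + 1) * om n) ≤
      volume.real (ball w ((1 - t) * s) ∩ F) := by
  have hom := om_pos n
  have hts : (1 - t) * s ≤ s := by nlinarith
  have hts0 : 0 ≤ (1 - t) * s := by
    have : 0 ≤ 1 - t := by linarith
    positivity
  have h1 := vol_split_s12 hF w hs.le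
  have h2 := vol_split_s12 hF w hts0
  have h3 := measureReal_mono (inter_subset_inter_left Fᶜ (ball_subset_ball (x := w) hts))
      (ball_inter_ne_top w s Fᶜ)
  have hb : 1 + ((n + 1 : ℕ) : ℝ) * (-t) ≤ (1 + -t) ^ (n + 1) :=
    one_add_mul_le_pow (by linarith) (n + 1)
  push_cast at hb
  rw [← sub_eq_add_neg] at hb
  have h4 : (1 + (n + 1) * -t) * (s ^ (n + 1) * om n) ≤ (1 - t) ^ (n + 1) * (s ^ (n + 1) * om n) := by
    gcongr
  rw [mul_pow] at h2
  nlinarith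

lemma point_ball {n : ℕ} {E : Set (V n)} (hE : MeasurableSet E) {lam : ℝ} (hl : 0 < lam)
    (hl1 : lam < 1) {U : Set (V n)} {x c : V n} {r : ℝ} (hr : 0 < r) (hU : ball c r ⊆ U)
    (hx : dist x c = r) (hxE : x ∉ mClos E)
    (h0 : lam * (r ^ (n + 1) * om n) ≤ volume.real (ball c r ∩ E)) :
    ∃ (w : V n) (s : ℝ), 0 < s ∧ dist x w = s ∧ ball w s ⊆ U ∧
      ENNReal.ofReal (ci n * lam ^ ((n : ℝ) / (n + 1)) * s ^ n) ≤
        μH[(n : ℝ)] (mBdry E ∩ ball w ((1 - kap n * lam) * s)) := by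
  have hom := om_pos n
  have hk := kap_pos n
  have hk1 := kap_lt n
  obtain ⟨w, s, hs, -, hd, hsub, h1, h2⟩ := stop_ball hE (τ := lam / 2) hr hx.le (by positivity) hxE
    (by refine le_trans ?_ h0; gcongr; linarith)
  have hkl0 : 0 < kap n * lam := by positivity
  have hkl : kap n * lam < 1 := by nlinarith
  refine ⟨w, s, hs, ?_, hsub.trans hU, ?_⟩
  · rw [hx, mul_comm r s] at hd
    exact mul_right_cancel₀ hr.ne' hd
  set B := s ^ (n + 1) * om n with hB
  have hB0 : 0 < B := by positivity
  have e1 : (n + 1) * (kap n * lam) = (1 / 2) ^ (n + 4) * lam := by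
    unfold kap; field_simp
  have s1 := shrink hE w hs hkl0.le hkl.le
  have s2 := shrink hE.compl w hs hkl0.le hkl.le
  rw [e1, ← hB] at s1 s2
  have hp : (1 / 2 : ℝ) ^ n ≤ 1 := pow_le_one₀ (by norm_num) (by norm_num)
  have hp0 : 0 < (1 / 2 : ℝ) ^ n := by positivity
  have g1 : lam / 4 * B ≤ volume.real (ball w ((1 - kap n * lam) * s) ∩ E) := by
    refine le_trans ?_ s1
    have : (1 / 2 : ℝ) ^ (n + 4) * lam * B ≤ 1 / 4 * lam * B := by
      gcongr
      rw [pow_add]; linarith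
    linarith
  have g2 : (1 / 2) ^ (n + 3) * B ≤ volume.real (ball w ((1 - kap n * lam) * s) ∩ Eᶜ) := by
    refine le_trans ?_ s2
    have a1 : (1 / 2 : ℝ) * (1 / 2) ^ (n + 1) * B ≤ (1 - lam / 2) * (1 / 2) ^ (n + 1) * B := by
      gcongr; linarith
    have a2 : (1 / 2 : ℝ) ^ (n + 4) * lam * B ≤ (1 / 2) ^ (n + 4) * 1 * B := by
      gcongr
    have a3 : (1 / 2 : ℝ) ^ (n + 4) = (1 / 2) ^ n / 16 := by rw [pow_add]; ring
    have a4 : (1 / 2 : ℝ) ^ (n + 3) = (1 / 2) ^ n / 8 := by rw [pow_add]; ring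
    have a5 : (1 / 2 : ℝ) ^ (n + 1) = (1 / 2) ^ n / 2 := by rw [pow_add]; ring
    rw [a3] at a2 ⊢
    rw [a5] at a1 h2
    rw [a4]
    nlinarith [mul_pos hp0 hB0]
  have hl' : 0 < 1 - kap n * lam := by linarith
  have hM : (lam ^ ((1 : ℝ) / (n + 1))) ^ (n + 1) = lam := by
    have := Real.rpow_inv_natCast_pow (n := n + 1) hl.le (by omega)
    rw [one_div]; push_cast at this; exact this
  have hM0 : 0 < lam ^ ((1 : ℝ) / (n + 1)) := Real.rpow_pos_of_pos hl _
  have := isoper hE w (R := (1 - kap n * lam) * s) (M := lam ^ ((1 : ℝ) / (n + 1)) * s)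
    (by positivity) (by positivity)
    (by
      refine le_trans ?_ g2
      rw [hB]
      gcongr
      nlinarith)
    (by
      have : (2 : ℝ) ^ (n + 2) * (lam / 4 * B) ≤
        2 ^ (n + 2) * volume.real (ball w ((1 - kap n * lam) * s) ∩ E) := by gcongr
      refine le_trans ?_ this
      rw [mul_pow, hM, mul_assoc, ← hB, pow_add]
      have : (1 : ℝ) ≤ 2 ^ n := one_le_pow₀ (by norm_num)
      have := mul_pos hl hB0
      nlinarith)
  refine le_trans (le_of_eq ?_) this
  rw [mul_pow, ← Real.rpow_natCast (lam ^ _) n, ← Real.rpow_mul hl.le]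
  congr 1
  rw [show (1 : ℝ) / (n + 1) * n = n / (n + 1) by ring]
  ring

lemma mem_mBdry_union {n : ℕ} {B : Finset (V n × ℝ)} {x : V n}
    (hx : x ∈ mBdry (⋃ p ∈ B, ball p.1 p.2)) :
    x ∉ (⋃ p ∈ B, ball p.1 p.2) ∧ ∃ p ∈ B, dist x p.1 = p.2 := by
  set U := ⋃ p ∈ B, ball p.1 p.2 with hU
  have hUo : IsOpen U := isOpen_biUnion fun _ _ => isOpen_ball
  have gen : ∀ F : Set (V n), (∃ δ > (0 : ℝ), ball x δ ∩ F = ∅) → x ∉ mClos F := by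
    rintro F ⟨δ, hδ, h⟩
    rw [not_mem_mClos_iff]
    intro ε hε
    refine ⟨δ, hδ, fun r hr hrδ => ?_⟩
    have : ball x r ∩ F = ∅ := subset_empty_iff.1
      ((inter_subset_inter_left F (ball_subset_ball hrδ.le)).trans h.le)
    rw [this, measureReal_empty]
    positivity
  have hxU : x ∉ U := by
    intro hxU
    obtain ⟨δ, hδ, h⟩ := Metric.isOpen_iff.1 hUo x hxU
    refine gen Uᶜ ⟨δ, hδ, ?_⟩ hx.2
    rw [← sdiff_eq]
    exact sdiff_eq_empty.2 h
  have hxc : x ∈ closure U := by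
    by_contra hcon
    obtain ⟨δ, hδ, h⟩ := Metric.isOpen_iff.1 isClosed_closure.isOpen_compl x hcon
    refine gen U ⟨δ, hδ, ?_⟩ hx.1
    rw [← disjoint_iff_inter_eq_empty]
    exact (disjoint_compl_left.mono_left h).mono_right subset_closure
  refine ⟨hxU, ?_⟩
  rw [hU, Finset.closure_biUnion] at hxc
  obtain ⟨p, hp, hxp⟩ := mem_iUnion₂.1 hxc
  refine ⟨p, hp, le_antisymm (mem_closedBall.1 (closure_ball_subset_closedBall hxp)) ?_⟩
  by_contra hcon
  rw [not_le] at hcon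
  exact hxU (mem_biUnion hp (mem_ball.2 hcon))

lemma scale_bound {n : ℕ} {C : ℝ} (hC : 0 ≤ C)
    (hlip : ∀ (S : Set (V n)) (z : V n) (ρ : ℝ), 0 < ρ → S ⊆ closedBall z (10 * ρ) →
      (∀ x ∈ S, ∃ (c : V n) (r : ℝ), ρ ≤ r ∧ dist x c = r ∧ Disjoint (ball c r) S) →
      μH[(n : ℝ)] S ≤ ENNReal.ofReal (C * ρ ^ n))
    {A U S : Set (V n)} {w : V n → V n} {s : V n → ℝ} {a γ : ℝ} (ha : 0 < a) (hγ : γ ≤ 1)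
    (hSU : ∀ x ∈ S, x ∉ U) (hd : ∀ x ∈ S, dist x (w x) = s x)
    (hb : ∀ x ∈ S, ball (w x) (s x) ⊆ U)
    (hm : ∀ x ∈ S, ENNReal.ofReal (a * s x ^ n) ≤ μH[(n : ℝ)] (A ∩ ball (w x) (γ * s x)))
    {ρ : ℝ} (hρ : 0 < ρ) (h1 : ∀ x ∈ S, ρ ≤ s x) (h2 : ∀ x ∈ S, s x < 2 * ρ) :
    ∃ W : Set (V n), MeasurableSet W ∧ (∀ y ∈ W, ∃ x ∈ S, y ∈ ball (w x) (γ * s x)) ∧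
      μH[(n : ℝ)] S ≤ ENNReal.ofReal (C / a) * (μH[(n : ℝ)].restrict A) W := by
  obtain ⟨u, huT, hdisj, hcov⟩ := Vitali.exists_disjoint_subfamily_covering_enlargement_closedBall
    S w s (2 * ρ) (fun a ha => (h2 a ha).le) 5 (by norm_num)
  have hs0 : ∀ x ∈ S, 0 < s x := fun x hx => hρ.trans_le (h1 x hx)
  have hdisj' : u.PairwiseDisjoint fun a => ball (w a) (s a) := fun a ha b hb hab =>
    (hdisj ha hb hab).mono ball_subset_closedBall ball_subset_closedBall
  have hcount : u.Countable := hdisj'.countable_of_isOpen (fun a _ => isOpen_ball)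
    (fun a ha => nonempty_ball.2 (hs0 a (huT ha)))
  have hγs : ∀ x ∈ S, γ * s x ≤ s x := fun x hx => by have := hs0 x hx; nlinarith
  have hdisj2 : u.PairwiseDisjoint fun a => ball (w a) (γ * s a) := fun a ha b hb hab =>
    (hdisj' ha hb hab).mono (ball_subset_ball (hγs a (huT ha))) (ball_subset_ball (hγs b (huT hb)))
  refine ⟨⋃ b ∈ u, ball (w b) (γ * s b), MeasurableSet.biUnion hcount fun _ _ => measurableSet_ball,
    ?_, ?_⟩
  · intro y hy
    obtain ⟨b, hb, hyb⟩ := mem_iUnion₂.1 hy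
    exact ⟨b, huT hb, hyb⟩
  calc μH[(n : ℝ)] S ≤ μH[(n : ℝ)] (⋃ b ∈ u, S ∩ closedBall (w b) (5 * s b)) := by
        apply measure_mono
        intro y hy
        obtain ⟨b, hb, hyb⟩ := hcov y hy
        exact mem_biUnion hb ⟨hy, hyb (mem_closedBall.2 (hd y hy).le)⟩
    _ ≤ ∑' b : u, μH[(n : ℝ)] (S ∩ closedBall (w b) (5 * s b)) := measure_biUnion_le _ hcount _
    _ ≤ ∑' b : u, ENNReal.ofReal (C / a) *
        (μH[(n : ℝ)].restrict A) (ball (w b) (γ * s b)) := by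
        apply ENNReal.tsum_le_tsum
        intro b
        have hbS := huT b.2
        have := hlip (S ∩ closedBall (w b) (5 * s b)) (w b) ρ hρ (by
          refine inter_subset_right.trans (closedBall_subset_closedBall ?_)
          have := h2 b hbS
          linarith) (by
          rintro x ⟨hx, -⟩
          refine ⟨w x, s x, h1 x hx, hd x hx, ?_⟩
          rw [disjoint_left]
          rintro y hy ⟨hyS, -⟩
          exact hSU y hyS (hb x hx hy))
        refine this.trans ?_
        rw [Measure.restrict_apply measurableSet_ball, inter_comm _ A]
        refine le_trans ?_ (mul_le_mul_right (hm b hbS) _)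
        rw [← ENNReal.ofReal_mul (by positivity)]
        apply ENNReal.ofReal_le_ofReal
        have := h1 b hbS
        calc C * ρ ^ n ≤ C * s b ^ n := by gcongr
          _ = _ := by field_simp
    _ = ENNReal.ofReal (C / a) * ∑' b : u, (μH[(n : ℝ)].restrict A) (ball (w b) (γ * s b)) :=
        ENNReal.tsum_mul_left
    _ = _ := by rw [measure_biUnion hcount hdisj2 fun _ _ => measurableSet_ball]

lemma overlap_sum {n : ℕ} {ν : Measure (V n)} {U : Set (V n)} (hU : MeasurableSet U)
    {W : ℤ → Set (V n)} (hW : ∀ m, MeasurableSet (W m)) (hWU : ∀ m, W m ⊆ U) {N : ℕ}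
    (hN : ∀ m m' y, y ∈ W m → y ∈ W m' → m' - m < N) :
    ∑' m, ν (W m) ≤ (2 * N : ℕ) * ν U := by
  calc ∑' m, ν (W m) = ∑' m, ∫⁻ y, (W m).indicator 1 y ∂ν := by
        congr 1; ext m; rw [lintegral_indicator_one (hW m)]
    _ = ∫⁻ y, ∑' m, (W m).indicator 1 y ∂ν :=
        (lintegral_tsum fun m => (measurable_one.indicator (hW m)).aemeasurable).symm
    _ ≤ ∫⁻ y, U.indicator (fun _ => ((2 * N : ℕ) : ℝ≥0∞)) y ∂ν := by
        apply lintegral_mono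
        intro y
        by_cases hy : ∃ m, y ∈ W m
        · obtain ⟨m, hm⟩ := hy
          dsimp only
          rw [indicator_of_mem (hWU m hm)]
          rw [tsum_eq_sum (s := Finset.Ioo (m - N) (m + N))]
          · calc _ ≤ ∑ i ∈ Finset.Ioo (m - (N : ℤ)) (m + N), (1 : ℝ≥0∞) := by
                  apply Finset.sum_le_sum
                  intro i _
                  apply indicator_le_self' (fun _ _ => zero_le_one)
              _ ≤ _ := by
                  rw [Finset.sum_const, nsmul_eq_mul, mul_one, Int.card_Ioo]
                  norm_cast
                  omega
          · intro i hi
            apply indicator_of_notMem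
            intro hyi
            apply hi
            have a1 := hN m i y hm hyi
            have a2 := hN i m y hyi hm
            rw [Finset.mem_Ioo]; omega
        · push Not at hy
          have : ∑' m, (W m).indicator (1 : V n → ℝ≥0∞) y = 0 := by
            rw [ENNReal.tsum_eq_zero]
            intro m
            exact indicator_of_notMem (hy m) _
          exact this.le.trans zero_le
    _ = _ := lintegral_indicator_const hU _

lemma main_aux_s12 (n : ℕ) : ∃ Cd : ℝ, 0 < Cd ∧
    ∀ (lam : ℝ), 0 < lam → lam < 1 → ∀ (E : Set (V n)), MeasurableSet E →
      ∀ ℬ : Finset (V n × ℝ),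
        (∀ p ∈ ℬ, 0 < p.2 ∧ ENNReal.ofReal lam * volume (ball p.1 p.2)
          < volume (E ∩ ball p.1 p.2)) →
        μH[(n : ℝ)] (mBdry (⋃ p ∈ ℬ, ball p.1 p.2) \ mClos E)
          ≤ ENNReal.ofReal (Cd * lam ^ (-(n : ℝ) / (n + 1)) * (1 - Real.log lam)) *
            μH[(n : ℝ)] (mBdry E ∩ ⋃ p ∈ ℬ, ball p.1 p.2) := by
  have hom := om_pos n
  have hci := ci_pos n
  have hk := kap_pos n
  have hk1 := kap_lt n
  obtain ⟨C, hC, hlip⟩ := lip_bdry n 10 (by norm_num)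
  have hlog2 : 0 < Real.log 2 := Real.log_pos (by norm_num)
  have hlogk : 0 < Real.log (4 / kap n) := Real.log_pos (by rw [lt_div_iff₀ hk]; linarith)
  set C2 : ℝ := 1 + Real.log (4 / kap n) / Real.log 2 + 1 / Real.log 2 with hC2
  have hC20 : 0 < C2 := by positivity
  refine ⟨2 * C2 * C / ci n + 1, by positivity, ?_⟩
  intro lam hl hl1 E hE ℬ hℬ
  set U := ⋃ p ∈ ℬ, ball p.1 p.2 with hU
  have hUo : IsOpen U := isOpen_biUnion fun _ _ => isOpen_ball
  set S := mBdry U \ mClos E with hS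
  set Λ := lam ^ ((n : ℝ) / (n + 1)) with hΛ
  have hΛ0 : 0 < Λ := Real.rpow_pos_of_pos hl _
  have hSU : ∀ x ∈ S, x ∉ U := fun x hx => (mem_mBdry_union hx.1).1
  have key : ∀ x ∈ S, ∃ (w : V n) (s : ℝ), 0 < s ∧ dist x w = s ∧ ball w s ⊆ U ∧
      ENNReal.ofReal (ci n * Λ * s ^ n) ≤
        μH[(n : ℝ)] (mBdry E ∩ ball w ((1 - kap n * lam) * s)) := by
    intro x hx
    obtain ⟨-, p, hp, hxp⟩ := mem_mBdry_union hx.1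
    obtain ⟨hp0, hpl⟩ := hℬ p hp
    refine point_ball hE hl hl1 hp0 (subset_biUnion_of_mem (u := fun p : V n × ℝ => ball p.1 p.2) hp)
      hxp hx.2 ?_
    rw [inter_comm, vol_ball _ hp0.le, ← ENNReal.ofReal_mul hl.le,
      ← ofReal_measureReal (ball_inter_ne_top p.1 p.2 E)] at hpl
    have := hpl.le
    rwa [ENNReal.ofReal_le_ofReal_iff measureReal_nonneg] at this
  choose! w s hs0 hd hb hm using key
  have hkl0 : 0 < kap n * lam := by positivity
  have hkl : kap n * lam < 1 := by nlinarith
  let Sm : ℤ → Set (V n) := fun m => {x | x ∈ S ∧ (2 : ℝ) ^ m ≤ s x ∧ s x < 2 * 2 ^ m}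
  have hScov : S ⊆ ⋃ m, Sm m := by
    intro x hx
    obtain ⟨m, hm1, hm2⟩ := exists_mem_Ico_zpow (hs0 x hx) (show (1 : ℝ) < 2 by norm_num)
    rw [zpow_add_one₀ (by norm_num), mul_comm] at hm2
    exact mem_iUnion.2 ⟨m, hx, hm1, hm2⟩
  have hW := fun m : ℤ => scale_bound hC hlip (A := mBdry E) (U := U) (S := Sm m) (w := w) (s := s)
    (a := ci n * Λ) (γ := 1 - kap n * lam) (by positivity) (by linarith)
    (fun x hx => hSU x hx.1) (fun x hx => hd x hx.1) (fun x hx => hb x hx.1)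
    (fun x hx => hm x hx.1) (ρ := 2 ^ m) (by positivity) (fun x hx => hx.2.1) (fun x hx => hx.2.2)
  choose W hWm hWx hWb using hW
  set N : ℕ := ⌈Real.log (4 / (kap n * lam)) / Real.log 2⌉₊ with hN
  have hNub : (N : ℝ) ≤ C2 * (1 - Real.log lam) := by
    have hll : Real.log lam < 0 := Real.log_neg hl hl1
    have e : Real.log (4 / (kap n * lam)) = Real.log (4 / kap n) - Real.log lam := by
      rw [← div_div, Real.log_div (by positivity) hl.ne']
    have h1 := (Nat.ceil_lt_add_one (a := Real.log (4 / (kap n * lam)) / Real.log 2)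
      (by rw [e]; apply div_nonneg _ hlog2.le; linarith)).le
    rw [← hN, e, sub_div] at h1
    have h2 : 0 ≤ (1 + Real.log (4 / kap n) / Real.log 2) * (-Real.log lam) :=
      mul_nonneg (by positivity) (by linarith)
    have h3 : 0 < 1 / Real.log 2 := by positivity
    rw [hC2]
    have h4 : Real.log lam / Real.log 2 = 1 / Real.log 2 * Real.log lam := by ring
    rw [h4] at h1
    nlinarith
  have hNlb : 4 / (kap n * lam) ≤ (2 : ℝ) ^ N := by
    have h1 := Nat.le_ceil (Real.log (4 / (kap n * lam)) / Real.log 2)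
    rw [← hN, div_le_iff₀ hlog2, ← Real.log_pow] at h1
    exact (Real.log_le_log_iff (by positivity) (by positivity)).1 h1
  have hgb : ∀ x ∈ S, ball (w x) ((1 - kap n * lam) * s x) ⊆ ball (w x) (s x) := by
    intro x hx
    apply ball_subset_ball
    have := hs0 x hx
    nlinarith
  have hWU : ∀ m, W m ⊆ U := by
    intro m y hy
    obtain ⟨x, hx, hyx⟩ := hWx m y hy
    exact hb x hx.1 (hgb x hx.1 hyx)
  have hov : ∀ m m' y, y ∈ W m → y ∈ W m' → m' - m < N := by
    intro m m' y hy hy'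
    obtain ⟨x, hx, hyx⟩ := hWx m y hy
    obtain ⟨x', hx', hyx'⟩ := hWx m' y hy'
    have h1 : dist y x < 4 * 2 ^ m := by
      have a1 := mem_ball.1 (hgb x hx.1 hyx)
      have a2 := hd x hx.1
      have a3 := dist_triangle_right y x (w x)
      have a4 := hx.2.2
      linarith
    have h2 : kap n * lam * 2 ^ m' < dist y x := by
      have a1 := mem_ball.1 hyx'
      have a2 : s x' ≤ dist x (w x') := by
        by_contra hcon
        rw [not_le] at hcon
        exact hSU x hx.1 (hb x' hx'.1 (mem_ball.2 hcon))
      have a3 := dist_triangle_left x (w x') y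
      have a4 : kap n * lam * 2 ^ m' ≤ kap n * lam * s x' := by
        have := hx'.2.1
        gcongr
      linarith
    have h3 : (2 : ℝ) ^ m' < 2 ^ (m + N) := by
      rw [zpow_add₀ (by norm_num), zpow_natCast]
      calc (2 : ℝ) ^ m' < 4 / (kap n * lam) * 2 ^ m := by
            rw [div_mul_eq_mul_div, lt_div_iff₀ hkl0]; linarith
        _ ≤ 2 ^ N * 2 ^ m := by gcongr
        _ = _ := mul_comm _ _
    have := (zpow_lt_zpow_iff_right₀ (show (1 : ℝ) < 2 by norm_num)).1 h3
    omega
  have hsum := overlap_sum (ν := (μH[(n : ℝ)] : Measure (V n)).restrict (mBdry E))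
    hUo.measurableSet hWm hWU hov
  rw [Measure.restrict_apply hUo.measurableSet, inter_comm] at hsum
  calc μH[(n : ℝ)] S ≤ μH[(n : ℝ)] (⋃ m, Sm m) := measure_mono hScov
    _ ≤ ∑' m, μH[(n : ℝ)] (Sm m) := measure_iUnion_le _
    _ ≤ ∑' m, ENNReal.ofReal (C / (ci n * Λ)) * (μH[(n : ℝ)].restrict (mBdry E)) (W m) :=
        ENNReal.tsum_le_tsum hWb
    _ = ENNReal.ofReal (C / (ci n * Λ)) * ∑' m, (μH[(n : ℝ)].restrict (mBdry E)) (W m) :=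
        ENNReal.tsum_mul_left
    _ ≤ ENNReal.ofReal (C / (ci n * Λ)) * ((2 * N : ℕ) * μH[(n : ℝ)] (mBdry E ∩ U)) := by gcongr
    _ = ENNReal.ofReal (C / (ci n * Λ) * (2 * N)) * μH[(n : ℝ)] (mBdry E ∩ U) := by
        rw [← mul_assoc, ENNReal.ofReal_mul (p := C / (ci n * Λ)) (by positivity)]
        congr 2
        rw [← ENNReal.ofReal_natCast]; push_cast; rfl
    _ ≤ _ := by
        refine mul_le_mul_left (ENNReal.ofReal_le_ofReal ?_) _
        have e : lam ^ (-(n : ℝ) / (n + 1)) = Λ⁻¹ := by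
          rw [neg_div, Real.rpow_neg hl.le]
        have hll : Real.log lam < 0 := Real.log_neg hl hl1
        rw [e]
        calc C / (ci n * Λ) * (2 * N) ≤ C / (ci n * Λ) * (2 * (C2 * (1 - Real.log lam))) := by gcongr
          _ = 2 * C2 * C / ci n * Λ⁻¹ * (1 - Real.log lam) := by field_simp
          _ ≤ _ := by
            have : 0 ≤ 1 - Real.log lam := by linarith
            gcongr
            linarith

/-- the key estimate for a finite union of balls each containing an
`E`-proportion larger than `λ`. -/
theorem stmt12 (d : ℕ) (hd : 1 ≤ d) :
    ∃ Cd : ℝ, 0 < Cd ∧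
      ∀ (lam : ℝ), 0 < lam → lam < 1 →
        ∀ (E : Set (EuclideanSpace ℝ (Fin d))), MeasurableSet E →
          HasLocFinitePerimeter E →
          ∀ ℬ : Finset (EuclideanSpace ℝ (Fin d) × ℝ),
            (∀ p ∈ ℬ, 0 < p.2 ∧
              ENNReal.ofReal lam * volume (Metric.ball p.1 p.2)
                < volume (E ∩ Metric.ball p.1 p.2)) →
            μH[(d : ℝ) - 1] (mBdry (⋃ p ∈ ℬ, Metric.ball p.1 p.2) \ mClos E)
              ≤ ENNReal.ofReal (Cd * lam ^ (-((d : ℝ) - 1) / d) * (1 - Real.log lam)) *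
                μH[(d : ℝ) - 1] (mBdry E ∩ ⋃ p ∈ ℬ, Metric.ball p.1 p.2) := by
  obtain ⟨n, rfl⟩ : ∃ n, d = n + 1 := ⟨d - 1, by omega⟩
  obtain ⟨Cd, h0, h⟩ := main_aux_s12 n
  refine ⟨Cd, h0, fun lam hl hl1 E hE _ ℬ hℬ => ?_⟩
  have e : (((n + 1 : ℕ) : ℝ)) - 1 = n := by push_cast; ring
  have e2 : -(((n + 1 : ℕ) : ℝ) - 1) / ((n + 1 : ℕ) : ℝ) = -(n : ℝ) / (n + 1) := by
    push_cast; ring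
  rw [e2, e]
  exact h lam hl hl1 E hE ℬ hℬ
end
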